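/- arXiv:1604.03230 — 2 statements merged into one kernel-verified Lean document; each statement's English description precedes it below -/
import Mathlib

section
/- Let C ⊆ D be a unital irreducible inclusion of C*-algebras (C' ∩ D = ℂ·I) acting on a separable Hilbert space H. Let A and B be separable intermediate C*-subalgebras for C ⊆ D with a conditional expectation E : D → B. Suppose C ⊆ A is crossed product-like by a discrete amenable group, and d(A,B) < 1/140. Then A = B. -/
/-- A discrete group is amenable iff it satisfies the Følner condition. -/
def FolnerAmenable (G : Type*) [Group G] : Prop :=
  ∀ (T : Finset G) (ε : ℝ), 0 < ε → ∃ F : Finset G, F.Nonempty ∧ ∀ g ∈ T,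
    haveI := Classical.decEq G
    ((symmDiff (F.image (fun x => g * x)) F).card : ℝ) < ε * F.card

/-- The Kadison–Kastler distance between two subsets of a C*-algebra: the Hausdorff
distance between their closed unit balls. -/
noncomputable def kkDist {E : Type*} [NormedAddCommGroup E] (S T : Set E) : ℝ :=
  Metric.hausdorffDist {x ∈ S | ‖x‖ ≤ 1} {x ∈ T | ‖x‖ ≤ 1}

section Tomiyama

variable {M : Type*} [CStarAlgebra M] [PartialOrder M] [StarOrderedRing M]

/-- Continuous functional calculus stays in a closed star subalgebra. -/
lemma aux_cfc_mem (B : StarSubalgebra ℂ M) (hB : IsClosed (B : Set M)) {a : M}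
    (ha : IsSelfAdjoint a) (haB : a ∈ B) (f : ℝ → ℝ) : cfc f a ∈ B := by
  rw [cfc_real_eq_complex f ha]
  exact StarAlgebra.elemental.le_of_mem hB haB (cfc_mem_elemental _ a)

/-- Orthogonality step in Tomiyama's theorem. -/
lemma aux_orth (D B : StarSubalgebra ℂ M) (hBD : B ≤ D) (E : M →ₗ[ℂ] M)
    (hE_range : ∀ x ∈ D, E x ∈ B) (hE_fix : ∀ b ∈ B, E b = b)
    (hE_contr : ∀ x ∈ D, ‖E x‖ ≤ ‖x‖)
    {h g x : M} (hh : h ∈ B) (hg : g ∈ B) (hx : x ∈ D) (hsa : IsSelfAdjoint h)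
    (hle : h * h ≤ h) (hhg : h * g = 0) : h * E (g * x) = 0 := by
  set z := E (g * x) with hz
  have hgxD : g * x ∈ D := mul_mem (hBD hg) hx
  have hzB : z ∈ B := hE_range _ hgxD
  have hhzB : h * z ∈ B := mul_mem hh hzB
  have hgh : star g * h = 0 := by
    have := congrArg star hhg
    simpa [hsa.star_eq] using this
  have h0 : 0 ≤ h * h := by
    have := star_mul_self_nonneg h
    rwa [hsa.star_eq] at this
  have key : ∀ t : ℝ, 0 < t → 2 * t * ‖h * z‖ ^ 2 ≤ ‖g * x‖ ^ 2 := by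
    intro t ht
    have hEv : E (g * x + (t : ℂ) • (h * z)) = z + (t : ℂ) • (h * z) := by
      rw [map_add, map_smul, hE_fix _ hhzB]
    have hD : g * x + (t : ℂ) • (h * z) ∈ D :=
      add_mem hgxD (D.smul_mem (hBD hhzB) _)
    have h1 : ‖z + (t : ℂ) • (h * z)‖ ≤ ‖g * x + (t : ℂ) • (h * z)‖ := by
      rw [← hEv]; exact hE_contr _ hD
    have h2 : ‖g * x + (t : ℂ) • (h * z)‖ ^ 2 ≤ ‖g * x‖ ^ 2 + t ^ 2 * ‖h * z‖ ^ 2 := by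
      have e : star (g * x + (t : ℂ) • (h * z)) * (g * x + (t : ℂ) • (h * z))
          = star (g * x) * (g * x) + ((t : ℂ) * t) • (star (h * z) * (h * z)) := by
        have c1 : star (g * x) * (h * z) = 0 := by
          rw [star_mul, mul_assoc, ← mul_assoc (star g), hgh, zero_mul, mul_zero]
        have c2 : star (h * z) * (g * x) = 0 := by
          rw [star_mul, hsa.star_eq, mul_assoc, ← mul_assoc h, hhg, zero_mul, mul_zero]
        simp only [star_add, star_smul, add_mul, mul_add, smul_mul_assoc, mul_smul_comm, c1, c2,
          smul_zero, add_zero, zero_add, smul_smul]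
        simp
      rw [sq, ← CStarRing.norm_star_mul_self, e]
      refine (norm_add_le _ _).trans ?_
      rw [norm_smul, CStarRing.norm_star_mul_self, CStarRing.norm_star_mul_self,
        norm_mul (t : ℂ), Complex.norm_real, Real.norm_eq_abs, abs_of_pos ht]
      apply le_of_eq; ring
    have h3 : (2 * t + t ^ 2) * ‖h * z‖ ^ 2 ≤ ‖z + (t : ℂ) • (h * z)‖ ^ 2 := by
      have e : star (z + (t : ℂ) • (h * z)) * (z + (t : ℂ) • (h * z))
          = star z * (1 + (2 * t) • h + (t ^ 2) • (h * h)) * z := by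
        have hz' : (t : ℂ) • (h * z) = t • (h * z) := by
          simp
        rw [hz']
        simp only [star_add, star_smul, star_mul, hsa.star_eq, add_mul, mul_add,
          smul_mul_assoc, mul_smul_comm, mul_one, mul_assoc, smul_smul, star_trivial]
        module
      have o : (2 * t + t ^ 2) • (h * h) ≤ 1 + (2 * t) • h + (t ^ 2) • (h * h) := by
        have : (2 * t) • (h * h) ≤ (2 * t) • h := smul_le_smul_of_nonneg_left hle (by positivity)
        rw [add_smul]
        gcongr
        calc (2 * t) • (h * h) ≤ (2 * t) • h := this
          _ ≤ 1 + (2 * t) • h := le_add_of_nonneg_left zero_le_one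
      have o2 := star_left_conjugate_le_conjugate o z
      have o3 : 0 ≤ star z * ((2 * t + t ^ 2) • (h * h)) * z :=
        star_left_conjugate_nonneg (smul_nonneg (by positivity) h0) z
      have o4 := CStarAlgebra.norm_le_norm_of_nonneg_of_le o3 o2
      rw [← e, CStarRing.norm_star_mul_self] at o4
      have e2 : star z * ((2 * t + t ^ 2) • (h * h)) * z
          = (2 * t + t ^ 2) • (star (h * z) * (h * z)) := by
        simp only [star_mul, hsa.star_eq, mul_smul_comm, smul_mul_assoc, mul_assoc]
      rw [e2, norm_smul, CStarRing.norm_star_mul_self, Real.norm_eq_abs,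
        abs_of_pos (by positivity)] at o4
      simpa [sq] using o4
    have h4 : ‖z + (t : ℂ) • (h * z)‖ ^ 2 ≤ ‖g * x + (t : ℂ) • (h * z)‖ ^ 2 := by
      gcongr
    nlinarith
  by_contra hne
  have hpos : 0 < ‖h * z‖ ^ 2 := by
    have := norm_pos_iff.mpr hne
    positivity
  have := key ((‖g * x‖ ^ 2 + 1) / ‖h * z‖ ^ 2) (by positivity)
  rw [mul_assoc, div_mul_cancel₀ _ hpos.ne'] at this
  nlinarith [sq_nonneg ‖g * x‖]

/-- The clamp function. -/
noncomputable def auxClamp (s : ℝ) : ℝ := max 0 (min 1 s)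

lemma auxClamp_cont : Continuous auxClamp := by unfold auxClamp; fun_prop

lemma auxClamp_sum (s : ℝ) (hs : 0 ≤ s) (n : ℕ) :
    ∑ j ∈ Finset.range n, auxClamp (s - j) = min s n := by
  induction n with
  | zero => simp [hs]
  | succ n ih =>
    rw [Finset.sum_range_succ, ih, auxClamp]
    push_cast
    rcases le_total s n with h | h
    · rw [min_eq_left h, min_eq_left (by linarith : s ≤ n + 1),
        min_eq_right (by linarith : s - n ≤ 1), max_eq_left (by linarith : s - n ≤ 0)]; ring
    · rw [min_eq_right h]
      rcases le_total s (n + 1) with h' | h'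
      · rw [min_eq_left h', min_eq_right (by linarith), max_eq_right (by linarith)]; ring
      · rw [min_eq_right h', min_eq_left (by linarith), max_eq_right (by linarith)]

lemma auxClamp_of_nonpos {s : ℝ} (h : s ≤ 0) : auxClamp s = 0 := by
  unfold auxClamp; rw [max_eq_left]; exact (min_le_right _ _).trans h

lemma auxClamp_of_one_le {s : ℝ} (h : 1 ≤ s) : auxClamp s = 1 := by
  unfold auxClamp; rw [min_eq_left h]; simp

lemma auxClamp_nonneg (s : ℝ) : 0 ≤ auxClamp s := le_max_left _ _
lemma auxClamp_le_one (s : ℝ) : auxClamp s ≤ 1 := by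
  unfold auxClamp; simp

/-- Norm bound for a sum of almost orthogonal elements. -/
lemma aux_sum_bound (n : ℕ) (y : ℕ → M) (K : ℝ) (hK : 0 ≤ K) (hy : ∀ j, ‖y j‖ ≤ K)
    (ho : ∀ j k, j + 2 ≤ k → star (y j) * y k = 0) :
    ‖∑ j ∈ Finset.range n, y j‖ ^ 2 ≤ n * (3 * K ^ 2) := by
  have ho' : ∀ j k, j + 2 ≤ k → star (y k) * y j = 0 := by
    intro j k h
    have := congrArg star (ho j k h)
    simpa using this
  rw [sq, ← CStarRing.norm_star_mul_self, star_sum, Finset.sum_mul]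
  refine (norm_sum_le _ _).trans ?_
  have : ∀ j ∈ Finset.range n, ‖star (y j) * ∑ k ∈ Finset.range n, y k‖ ≤ 3 * K ^ 2 := by
    intro j _
    rw [Finset.mul_sum]
    refine (norm_sum_le _ _).trans ?_
    have hb : ∀ k ∈ Finset.range n, ‖star (y j) * y k‖ ≤
        if k ∈ Finset.Icc (j - 1) (j + 1) then K ^ 2 else 0 := by
      intro k _
      split_ifs with hk
      · refine (norm_mul_le _ _).trans ?_
        rw [norm_star, sq]
        exact mul_le_mul (hy j) (hy k) (norm_nonneg _) hK
      · rw [Finset.mem_Icc] at hk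
        rcases Nat.lt_or_ge k j with h | h
        · rw [ho' k j (by omega)]; simp
        · rw [ho j k (by omega)]; simp
    refine (Finset.sum_le_sum hb).trans ?_
    rw [← Finset.sum_filter, Finset.sum_const, nsmul_eq_mul]
    gcongr
    have h1 : (Finset.filter (fun k => k ∈ Finset.Icc (j - 1) (j + 1)) (Finset.range n)).card
        ≤ (Finset.Icc (j - 1) (j + 1)).card := by
      apply Finset.card_le_card
      intro k hk
      exact (Finset.mem_filter.mp hk).2
    rw [Nat.card_Icc] at h1
    have : (Finset.filter (fun k => k ∈ Finset.Icc (j - 1) (j + 1)) (Finset.range n)).card ≤ 3 := by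
      omega
    exact_mod_cast this
  refine (Finset.sum_le_sum this).trans ?_
  simp

/-- Left module property for self-adjoint elements. -/
lemma aux_left_sa [Nontrivial M] (D B : StarSubalgebra ℂ M) (hBD : B ≤ D)
    (hB : IsClosed (B : Set M)) (E : M →ₗ[ℂ] M)
    (hE_range : ∀ x ∈ D, E x ∈ B) (hE_fix : ∀ b ∈ B, E b = b)
    (hE_contr : ∀ x ∈ D, ‖E x‖ ≤ ‖x‖)
    {a x : M} (ha : a ∈ B) (hsa : IsSelfAdjoint a) (hx : x ∈ D) : E (a * x) = a * E x := by
  -- the defect map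
  let δ : M →ₗ[ℂ] M :=
    { toFun := fun b => E (b * x) - b * E x
      map_add' := by intro b c; simp only [add_mul, map_add]; abel
      map_smul' := by
        intro c b
        simp only [smul_mul_assoc, map_smul, RingHom.id_apply, smul_sub] }
  have hδ : ∀ b, δ b = E (b * x) - b * E x := fun _ => rfl
  have hδ1 : δ 1 = 0 := by simp [hδ]
  suffices h : δ a = 0 by rwa [hδ, sub_eq_zero] at h
  set R : ℝ := ‖a‖ + 1 with hR
  have hRpos : 0 < R := by positivity
  have hspec : ∀ t ∈ spectrum ℝ a, |t| ≤ R := by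
    intro t ht
    have := spectrum.norm_le_norm_of_mem ht
    rw [Real.norm_eq_abs] at this
    linarith
  have key : ∀ n : ℕ, ‖((n / (2 * R) : ℝ) : ℂ) • δ a‖ ^ 2 ≤ n * (3 * (2 * ‖x‖) ^ 2) := by
    intro n
    let f : ℕ → ℝ → ℝ := fun j t => auxClamp (n * ((t + R) / (2 * R)) - j)
    have hf : ∀ j, Continuous (f j) := by
      intro j
      exact auxClamp_cont.comp (by fun_prop)
    let r : ℕ → M := fun j => cfc (f j) a
    have hrB : ∀ j, r j ∈ B := fun j => aux_cfc_mem B hB hsa ha _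
    have hrsa : ∀ j, IsSelfAdjoint (r j) := fun j => cfc_predicate _ a
    have hr0 : ∀ j, 0 ≤ r j := fun j => cfc_nonneg (fun t _ => auxClamp_nonneg _)
    have hr1 : ∀ j, r j ≤ 1 := fun j => cfc_le_one _ _ (fun t _ => auxClamp_le_one _)
    have hrn : ∀ j, ‖r j‖ ≤ 1 := fun j => by
      exact (CStarAlgebra.norm_le_one_iff_of_nonneg _ (hr0 j)).mpr (hr1 j)
    have hrr : ∀ j, r j * r j ≤ r j := by
      intro j
      simp only [r]
      rw [← cfc_mul _ _ a (hf j).continuousOn (hf j).continuousOn]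
      apply cfc_mono (fun t _ => ?_) ((hf j).mul (hf j)).continuousOn (hf j).continuousOn
      exact mul_le_of_le_one_left (auxClamp_nonneg _) (auxClamp_le_one _)
    have hm : ∀ j k, j + 1 ≤ k → r k * (r j - 1) = 0 := by
      intro j k hjk
      simp only [r]
      rw [← cfc_one ℝ a, ← cfc_sub _ _ a (hf j).continuousOn (by fun_prop),
        ← cfc_mul (f k) (fun x => f j x - (1 : ℝ → ℝ) x) a (hf k).continuousOn
          ((hf j).sub continuous_one).continuousOn]
      rw [← cfc_zero ℝ a]
      congr 1
      ext t
      have hjk' : (j : ℝ) + 1 ≤ k := by exact_mod_cast hjk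
      simp only [Pi.one_apply, Pi.zero_apply, f]
      rcases le_total (n * ((t + R) / (2 * R))) (k : ℝ) with h | h
      · rw [auxClamp_of_nonpos (by linarith)]; simp
      · rw [auxClamp_of_one_le (by linarith : 1 ≤ n * ((t + R) / (2 * R)) - (j : ℝ))]; simp
    have hm' : ∀ j k, j + 1 ≤ k → (1 - r j) * r k = 0 := by
      intro j k hjk
      have := congrArg star (hm j k hjk)
      rw [star_mul, star_sub, star_one, (hrsa j).star_eq, (hrsa k).star_eq, star_zero] at this
      rw [← neg_sub, neg_mul, this, neg_zero]
    have hsum : ∑ j ∈ Finset.range n, r j = ((n / (2 * R) : ℝ) : ℂ) • a + ((n / 2 : ℝ) : ℂ) • 1 := by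
      simp only [r]
      rw [← cfc_sum _ a _ (fun j _ => (hf j).continuousOn)]
      have e : cfc (fun t : ℝ => (n / (2 * R)) * t + n / 2) a
          = ((n / (2 * R) : ℝ) : ℂ) • a + ((n / 2 : ℝ) : ℂ) • 1 := by
        rw [cfc_add _ _ _ (by fun_prop) (by fun_prop), cfc_const_mul _ _ _ (by fun_prop),
          cfc_id' ℝ a, cfc_const _ a, Algebra.algebraMap_eq_smul_one]
        simp only [Complex.coe_smul]
      rw [← e]
      apply cfc_congr
      intro t ht
      have ht' := abs_le.mp (hspec t ht)
      have h0 : 0 ≤ (t + R) / (2 * R) := div_nonneg (by linarith) (by linarith)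
      have h1 : (t + R) / (2 * R) ≤ 1 := by rw [div_le_one (by linarith)]; linarith
      have := auxClamp_sum (n * ((t + R) / (2 * R))) (by positivity) n
      simp only [Finset.sum_apply, f]
      rw [this, min_eq_left (mul_le_of_le_one_right (by positivity) h1)]
      field_simp
    have hδsum : ∑ j ∈ Finset.range n, δ (r j) = ((n / (2 * R) : ℝ) : ℂ) • δ a := by
      rw [← map_sum, hsum, map_add, map_smul, map_smul, hδ1, smul_zero, add_zero]
    rw [← hδsum]
    apply aux_sum_bound n (fun j => δ (r j)) _ (by positivity)
    · intro j
      rw [hδ]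
      have n1 : ‖E (r j * x)‖ ≤ ‖x‖ := by
        refine (hE_contr _ (mul_mem (hBD (hrB j)) hx)).trans ((norm_mul_le _ _).trans ?_)
        exact mul_le_of_le_one_left (norm_nonneg _) (hrn j)
      have n2 : ‖r j * E x‖ ≤ ‖x‖ := by
        refine (norm_mul_le _ _).trans ?_
        exact (mul_le_of_le_one_left (norm_nonneg _) (hrn j)).trans (hE_contr _ hx)
      exact (norm_sub_le _ _).trans (by linarith)
    · intro j k hjk
      have a1 : r (j + 1) * δ (r j) = 0 := by
        have : δ (r j) = δ (r j - 1) := by rw [map_sub, hδ1, sub_zero]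
        rw [this, hδ, mul_sub, ← mul_assoc, hm j (j + 1) le_rfl, zero_mul, sub_zero]
        exact aux_orth D B hBD E hE_range hE_fix hE_contr (hrB _)
          (sub_mem (hrB _) (one_mem _)) hx (hrsa _) (hrr _) (hm j (j + 1) le_rfl)
      have a2 : (1 - r (j + 1)) * δ (r k) = 0 := by
        rw [hδ, mul_sub, ← mul_assoc, hm' (j + 1) k hjk, zero_mul, sub_zero]
        refine aux_orth D B hBD E hE_range hE_fix hE_contr (sub_mem (one_mem _) (hrB _))
          (hrB _) hx ((IsSelfAdjoint.one _).sub (hrsa _)) ?_ (hm' (j + 1) k hjk)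
        have : (1 - r (j + 1)) * (1 - r (j + 1))
            = (1 - r (j + 1)) - (r (j + 1) - r (j + 1) * r (j + 1)) := by noncomm_ring
        rw [this]
        exact sub_le_self _ (sub_nonneg.mpr (hrr _))
      have a3 : star (δ (r j)) * r (j + 1) = 0 := by
        have := congrArg star a1
        rwa [star_mul, (hrsa _).star_eq, star_zero] at this
      have a4 : δ (r k) = r (j + 1) * δ (r k) := by
        rw [sub_mul, one_mul, sub_eq_zero] at a2; exact a2
      show star (δ (r j)) * δ (r k) = 0
      rw [a4, ← mul_assoc, a3, zero_mul]
  by_contra hne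
  have hpos : 0 < ‖δ a‖ ^ 2 := by
    have := norm_pos_iff.mpr hne
    positivity
  obtain ⟨n, hn⟩ := exists_nat_gt ((3 * (2 * ‖x‖) ^ 2) * (2 * R) ^ 2 / ‖δ a‖ ^ 2)
  have hn0 : 0 < (n : ℝ) := lt_of_le_of_lt (by positivity) hn
  have k1 := key n
  rw [norm_smul, Complex.norm_real, Real.norm_eq_abs, abs_of_pos (by positivity), mul_pow,
    div_pow, div_mul_eq_mul_div, div_le_iff₀ (by positivity)] at k1
  rw [div_lt_iff₀ hpos] at hn
  have : (n : ℝ) * (n * ‖δ a‖ ^ 2) ≤ n * ((3 * (2 * ‖x‖) ^ 2) * (2 * R) ^ 2) := by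
    linarith [k1, sq (n : ℝ), mul_assoc (n : ℝ) n (‖δ a‖ ^ 2)]
  have := le_of_mul_le_mul_left this hn0
  linarith

/-- Left module property (Tomiyama). -/
lemma aux_left [Nontrivial M] (D B : StarSubalgebra ℂ M) (hBD : B ≤ D)
    (hB : IsClosed (B : Set M)) (E : M →ₗ[ℂ] M)
    (hE_range : ∀ x ∈ D, E x ∈ B) (hE_fix : ∀ b ∈ B, E b = b)
    (hE_contr : ∀ x ∈ D, ‖E x‖ ≤ ‖x‖)
    {b x : M} (hb : b ∈ B) (hx : x ∈ D) : E (b * x) = b * E x := by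
  have hs : star b ∈ B := star_mem hb
  have h1 := aux_left_sa D B hBD hB E hE_range hE_fix hE_contr (add_mem hb hs)
    (IsSelfAdjoint.add_star_self b) hx
  have h2 := aux_left_sa D B hBD hB E hE_range hE_fix hE_contr
    (B.smul_mem (sub_mem hb hs) Complex.I)
    (by rw [IsSelfAdjoint, star_smul, star_sub, star_star]; simp [smul_sub]; abel) hx
  rw [smul_mul_assoc, map_smul, smul_mul_assoc] at h2
  have h3 := smul_right_injective M Complex.I_ne_zero h2
  rw [add_mul, map_add, add_mul] at h1
  rw [sub_mul, map_sub, sub_mul] at h3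
  have h4 : (2 : ℂ) • E (b * x) = (2 : ℂ) • (b * E x) := by
    rw [two_smul, two_smul]
    calc E (b * x) + E (b * x) = (E (b * x) + E (star b * x)) + (E (b * x) - E (star b * x)) := by
          abel
      _ = _ := by rw [h1, h3]; abel
  exact smul_right_injective M two_ne_zero h4

/-- Right module property (Tomiyama). -/
lemma aux_right [Nontrivial M] (D B : StarSubalgebra ℂ M) (hBD : B ≤ D)
    (hB : IsClosed (B : Set M)) (E : M →ₗ[ℂ] M)
    (hE_range : ∀ x ∈ D, E x ∈ B) (hE_fix : ∀ b ∈ B, E b = b)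
    (hE_contr : ∀ x ∈ D, ‖E x‖ ≤ ‖x‖)
    {b x : M} (hb : b ∈ B) (hx : x ∈ D) : E (x * b) = E x * b := by
  let E' : M →ₗ[ℂ] M :=
    { toFun := fun y => star (E (star y))
      map_add' := by intro y z; simp
      map_smul' := by intro c y; simp }
  have hE' : ∀ y, E' y = star (E (star y)) := fun _ => rfl
  have := aux_left D B hBD hB E' (fun y hy => star_mem (hE_range _ (star_mem hy)))
    (fun y hy => by rw [hE', hE_fix _ (star_mem hy), star_star])
    (fun y hy => by
      rw [hE', norm_star]
      simpa using hE_contr _ (star_mem hy))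
    (star_mem hb) (star_mem hx)
  have := congrArg star this
  simpa [hE'] using this

end Tomiyama

/-- Let `C ⊆ D` be a unital irreducible inclusion of C*-algebras
(`C' ∩ D = ℂ·I`) acting on a separable Hilbert space `H`.  Let `A`, `B` be separable
intermediate C*-subalgebras for `C ⊆ D` with a conditional expectation `E : D → B`.
Suppose `C ⊆ A` is crossed product-like by a discrete amenable group and `d(A,B) < 1/140`.
Then `A = B`. -/
theorem stmt17 {H : Type*} [NormedAddCommGroup H] [InnerProductSpace ℂ H] [CompleteSpace H]
    [TopologicalSpace.SeparableSpace H]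
    (C D A B : StarSubalgebra ℂ (H →L[ℂ] H))
    (hC_closed : IsClosed (C : Set (H →L[ℂ] H))) (hD_closed : IsClosed (D : Set (H →L[ℂ] H)))
    (hA_closed : IsClosed (A : Set (H →L[ℂ] H))) (hB_closed : IsClosed (B : Set (H →L[ℂ] H)))
    (hCA : C ≤ A) (hAD : A ≤ D) (hCB : C ≤ B) (hBD : B ≤ D)
    -- the inclusion `C ⊆ D` is irreducible:
    (hirr : Set.centralizer (C : Set (H →L[ℂ] H)) ∩ (D : Set (H →L[ℂ] H)) =
      Set.range (fun z : ℂ => z • (1 : H →L[ℂ] H)))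
    -- `A` and `B` are separable:
    (hA_sep : TopologicalSpace.IsSeparable (A : Set (H →L[ℂ] H)))
    (hB_sep : TopologicalSpace.IsSeparable (B : Set (H →L[ℂ] H)))
    -- `E` is a conditional expectation of `D` onto `B`:
    (E : (H →L[ℂ] H) →ₗ[ℂ] (H →L[ℂ] H))
    (hE_range : ∀ x ∈ D, E x ∈ B) (hE_fix : ∀ b ∈ B, E b = b)
    (hE_contr : ∀ x ∈ D, ‖E x‖ ≤ ‖x‖)
    -- `C ⊆ A` is crossed product-like by a discrete amenable group `U`:
    (U : Subgroup (unitary (H →L[ℂ] H)))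
    (hUA : ∀ u ∈ U, ((u : unitary (H →L[ℂ] H)) : H →L[ℂ] H) ∈ A)
    (hUnorm : ∀ u ∈ U,
      (fun x => ((u : unitary (H →L[ℂ] H)) : H →L[ℂ] H) * x *
        star ((u : unitary (H →L[ℂ] H)) : H →L[ℂ] H)) '' (C : Set (H →L[ℂ] H)) =
          (C : Set (H →L[ℂ] H)))
    (hgen : (StarAlgebra.adjoin ℂ ((C : Set (H →L[ℂ] H)) ∪
        ((fun u : unitary (H →L[ℂ] H) => (u : H →L[ℂ] H)) ''
          (U : Set (unitary (H →L[ℂ] H)))))).topologicalClosure = A)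
    (hU_amen : FolnerAmenable U)
    (hd : kkDist (A : Set (H →L[ℂ] H)) (B : Set (H →L[ℂ] H)) < 1 / 140) :
    A = B := by
  rcases subsingleton_or_nontrivial H with hH | hH
  · ext x
    have : x = 0 := Subsingleton.elim _ _
    subst this
    exact ⟨fun _ => zero_mem B, fun _ => zero_mem A⟩
  have hfin : Metric.hausdorffEDist {x ∈ (A : Set (H →L[ℂ] H)) | ‖x‖ ≤ 1}
      {x ∈ (B : Set (H →L[ℂ] H)) | ‖x‖ ≤ 1} ≠ ⊤ := by
    apply Metric.hausdorffEDist_ne_top_of_nonempty_of_bounded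
    · exact ⟨0, zero_mem A, by simp⟩
    · exact ⟨0, zero_mem B, by simp⟩
    · exact isBounded_iff_forall_norm_le.mpr ⟨1, fun x hx => hx.2⟩
    · exact isBounded_iff_forall_norm_le.mpr ⟨1, fun x hx => hx.2⟩
  unfold kkDist at hd
  have hAB : ∀ a ∈ A, ‖a‖ ≤ 1 → ∃ b ∈ B, ‖a - b‖ < 1 / 140 := by
    intro a ha ha1
    obtain ⟨b, hb, hab⟩ := Metric.exists_dist_lt_of_hausdorffDist_lt
      (x := a) (s := {x ∈ (A : Set (H →L[ℂ] H)) | ‖x‖ ≤ 1}) ⟨ha, ha1⟩ hd hfin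
    exact ⟨b, hb.1, by rwa [dist_eq_norm] at hab⟩
  have hBA : ∀ b ∈ B, ‖b‖ ≤ 1 → ∃ a ∈ A, ‖b - a‖ < 1 / 140 := by
    intro b hb hb1
    obtain ⟨a, ha, hab⟩ := Metric.exists_dist_lt_of_hausdorffDist_lt'
      (y := b) (t := {x ∈ (B : Set (H →L[ℂ] H)) | ‖x‖ ≤ 1}) ⟨hb, hb1⟩ hd hfin
    exact ⟨a, ha.1, by rwa [dist_comm, dist_eq_norm] at hab⟩
  have hUB : ∀ u ∈ U, ((u : unitary (H →L[ℂ] H)) : H →L[ℂ] H) ∈ B := by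
    intro u hu
    set v : H →L[ℂ] H := (u : H →L[ℂ] H) with hv
    have huu : star v * v = 1 := Unitary.coe_star_mul_self u
    have huu' : v * star v = 1 := Unitary.coe_mul_star_self u
    have hvD : v ∈ D := hAD (hUA u hu)
    have hvn : ‖v‖ = 1 := CStarRing.norm_coe_unitary u
    have hcomm : star v * E v ∈ Set.centralizer (C : Set (H →L[ℂ] H)) ∩ D := by
      refine ⟨?_, mul_mem (star_mem hvD) (hBD (hE_range _ hvD))⟩
      intro c hc
      have hα : v * c * star v ∈ (C : Set (H →L[ℂ] H)) := by
        rw [← hUnorm u hu]; exact ⟨c, hc, rfl⟩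
      have e1 : E (v * c) = E v * c :=
        aux_right D B hBD hB_closed E hE_range hE_fix hE_contr (hCB hc) hvD
      have e2 : E (v * c * star v * v) = v * c * star v * E v :=
        aux_left D B hBD hB_closed E hE_range hE_fix hE_contr (hCB hα) hvD
      rw [mul_assoc (v * c), huu, mul_one, e1] at e2
      rw [mul_assoc, e2, ← mul_assoc, ← mul_assoc, ← mul_assoc, ← mul_assoc, huu, one_mul]
    rw [hirr] at hcomm
    obtain ⟨z, hz⟩ := hcomm
    have hEz : E v = z • v := by
      calc E v = v * (star v * E v) := by rw [← mul_assoc, huu', one_mul]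
        _ = z • v := by rw [← hz]; simp
    obtain ⟨b, hb, hvb⟩ := hAB v (hUA u hu) hvn.le
    have hz0 : z ≠ 0 := by
      rintro rfl
      rw [zero_smul] at hEz
      have h1 := hE_contr (v - b) (sub_mem hvD (hBD hb))
      rw [map_sub, hEz, hE_fix b hb, zero_sub, norm_neg] at h1
      have h2 : ‖v‖ ≤ ‖v - b‖ + ‖b‖ := by
        simpa using norm_add_le (v - b) b
      linarith
    have : v = z⁻¹ • E v := by rw [hEz, smul_smul, inv_mul_cancel₀ hz0, one_smul]
    rw [this]
    exact B.smul_mem (hE_range _ hvD) _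
  have hle : A ≤ B := by
    rw [← hgen]
    apply StarSubalgebra.topologicalClosure_minimal _ hB_closed
    apply StarAlgebra.adjoin_le
    rintro x (hx | ⟨u, hu, rfl⟩)
    · exact hCB hx
    · exact hUB u hu
  refine le_antisymm hle ?_
  intro x hx
  by_contra hxA
  have hne : (A : Set (H →L[ℂ] H)).Nonempty := ⟨0, zero_mem A⟩
  have hdpos : 0 < Metric.infDist x (A : Set (H →L[ℂ] H)) :=
    (hA_closed.notMem_iff_infDist_pos hne).mp hxA
  obtain ⟨a, ha, hxa⟩ := (Metric.infDist_lt_iff hne).mp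
    (by linarith : Metric.infDist x (A : Set (H →L[ℂ] H))
      < 2 * Metric.infDist x (A : Set (H →L[ℂ] H)))
  rw [dist_eq_norm] at hxa
  set s := ‖x - a‖ with hs
  have hspos : 0 < s := by
    have := Metric.infDist_le_dist_of_mem (x := x) ha
    rw [dist_eq_norm] at this
    linarith
  have hsC : (s : ℂ) ≠ 0 := by exact_mod_cast hspos.ne'
  obtain ⟨a', ha', h'⟩ := hBA (((s : ℂ))⁻¹ • (x - a)) (B.smul_mem (sub_mem hx (hle ha)) _) (by
    rw [norm_smul, norm_inv, Complex.norm_real, Real.norm_eq_abs, abs_of_pos hspos,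
      inv_mul_cancel₀ hspos.ne'])
  have h2 := Metric.infDist_le_dist_of_mem (x := x) (add_mem ha (A.smul_mem ha' (s : ℂ)))
  rw [dist_eq_norm] at h2
  have h3 : x - (a + (s : ℂ) • a') = (s : ℂ) • ((s : ℂ)⁻¹ • (x - a) - a') := by
    rw [smul_sub, smul_smul, mul_inv_cancel₀ hsC, one_smul]; abel
  rw [h3, norm_smul, Complex.norm_real, Real.norm_eq_abs, abs_of_pos hspos] at h2
  nlinarith
end

section
/- Let C ⊆ D be a unital inclusion of C*-algebras and A, B separable intermediate C*-subalgebras with a conditional expectation E : D → B. Suppose C ⊆ A is crossed product-like by a discrete amenable group and d(A,B) < γ < 10^{-3}. Then there exists a surjective *-isomorphism α : A → B with α|_C = id_C; moreover, given any finite subset X of the unit ball of A, α can be chosen with ‖α(x) - x‖ ≤ 15γ for all x ∈ X. -/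
section Tomiyama

variable {D : Type*} [CStarAlgebra D] [PartialOrder D] [StarOrderedRing D]

lemma tom_orth (B : StarSubalgebra ℂ D) (E : D →ₗ[ℂ] D)
    (hE_range : ∀ x, E x ∈ B) (hE_fix : ∀ b ∈ B, E b = b) (hE_contr : ∀ x, ‖E x‖ ≤ ‖x‖)
    (k f : D) (hkB : k ∈ B) (hk0 : 0 ≤ k) (hk1 : k ≤ 1) (hf : IsSelfAdjoint f)
    (hkf : k * f = 0) (x : D) : k * E (f * x) = 0 := by
  have hks : star k = k := (IsSelfAdjoint.of_nonneg hk0).star_eq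
  have hfs : star f = f := hf.star_eq
  have hfk : f * k = 0 := by
    have := congrArg star hkf
    simpa [hks, hfs] using this
  set v := E (f * x) with hv
  have hvB : v ∈ B := hE_range _
  have hkv : E (k * v) = k * v := hE_fix _ (mul_mem hkB hvB)
  have hkk : k ^ 2 ≤ k := by
    have := CStarAlgebra.pow_antitone hk0 hk1 (show 1 ≤ 2 by norm_num)
    simpa using this
  have key : ∀ t : ℝ, 0 ≤ t → 2 * t * ‖k * v‖ ^ 2 ≤ ‖f * x‖ ^ 2 := by
    intro t ht
    have h1 : E (f * x + (t : ℂ) • (k * v)) = v + (t : ℂ) • (k * v) := by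
      rw [map_add, map_smul, hkv]
    have h2 : ‖v + (t : ℂ) • (k * v)‖ ^ 2 ≤ ‖f * x + (t : ℂ) • (k * v)‖ ^ 2 := by
      rw [← h1]; gcongr; exact hE_contr _
    have h3 : ‖f * x + (t : ℂ) • (k * v)‖ ^ 2 ≤ ‖f * x‖ ^ 2 + t ^ 2 * ‖k * v‖ ^ 2 := by
      rw [sq, ← CStarRing.norm_star_mul_self]
      have e : star (f * x + (t : ℂ) • (k * v)) * (f * x + (t : ℂ) • (k * v))
          = star (f * x) * (f * x) + ((t : ℂ) ^ 2) • (star (k * v) * (k * v)) := by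
        have e1 : star (f * x) * (k * v) = 0 := by
          rw [star_mul, hfs, mul_assoc, ← mul_assoc f, hfk]; simp
        have e2 : star (k * v) * (f * x) = 0 := by
          rw [star_mul, hks, mul_assoc, ← mul_assoc k, hkf]; simp
        rw [star_add, star_smul, add_mul, mul_add, mul_add, smul_mul_assoc, smul_mul_assoc,
          mul_smul_comm, mul_smul_comm, e1, e2, smul_smul]
        simp [sq]
      rw [e]
      refine (norm_add_le _ _).trans ?_
      rw [norm_smul, CStarRing.norm_star_mul_self, CStarRing.norm_star_mul_self]
      simp [sq, abs_of_nonneg ht]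
    have h4 : (2 * t + t ^ 2) * ‖k * v‖ ^ 2 ≤ ‖v + (t : ℂ) • (k * v)‖ ^ 2 := by
      have hn : ((2 * t + t ^ 2 : ℝ) : ℝ) * ‖k * v‖ ^ 2
          = ‖((2 * t + t ^ 2 : ℝ)) • (star (k * v) * (k * v))‖ := by
        rw [norm_smul, CStarRing.norm_star_mul_self, Real.norm_of_nonneg (by positivity), sq ‖k * v‖]
      rw [hn, sq ‖v + (t : ℂ) • (k * v)‖, ← CStarRing.norm_star_mul_self]
      refine CStarAlgebra.norm_le_norm_of_nonneg_of_le ?_ ?_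
      · exact smul_nonneg (by positivity) (star_mul_self_nonneg _)
      · rw [← sub_nonneg]
        have e : star (v + (t : ℂ) • (k * v)) * (v + (t : ℂ) • (k * v))
            - (2 * t + t ^ 2) • (star (k * v) * (k * v))
            = star v * (1 + (2 * t) • (k - k ^ 2)) * v := by
          simp only [star_add, star_smul, star_mul, hks, Complex.coe_smul, mul_add, add_mul,
            mul_sub, sub_mul, smul_mul_assoc, mul_smul_comm, sq, mul_assoc, star_trivial,
            smul_sub, mul_one]
          module
        rw [e]
        apply star_left_conjugate_nonneg
        have : (0:D) ≤ 1 := zero_le_one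
        have h5 : 0 ≤ (2 * t) • (k - k ^ 2) := smul_nonneg (by positivity) (sub_nonneg.2 hkk)
        exact add_nonneg this h5
    nlinarith
  by_contra hne
  have hpos : 0 < ‖k * v‖ ^ 2 := by positivity
  have := key ((‖f * x‖ ^ 2 + 1) / ‖k * v‖ ^ 2) (by positivity)
  have e : 2 * ((‖f * x‖ ^ 2 + 1) / ‖k * v‖ ^ 2) * ‖k * v‖ ^ 2 = 2 * (‖f * x‖ ^ 2 + 1) := by
    field_simp
  rw [e] at this
  nlinarith [sq_nonneg ‖f * x‖]

open scoped InnerProductSpace in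
lemma row_cs {n : ℕ} (f z : Fin n → D) :
    ‖∑ i, f i * z i‖ ^ 2 ≤ ‖∑ i, f i * star (f i)‖ * ∑ i, ‖z i‖ ^ 2 := by
  let F : WithCStarModule D (Fin n → D) := (WithCStarModule.equiv D _).symm f
  let Z : WithCStarModule D (Fin n → D) := (WithCStarModule.equiv D _).symm (fun i => star (z i))
  have h := CStarModule.norm_inner_le (A := D) (WithCStarModule D (Fin n → D)) (x := Z) (y := F)
  have h1 : (inner D Z F : D) = ∑ i, f i * z i := by
    change ∑ i, f i * star (star (z i)) = _
    simp
  have h2 : ‖F‖ ^ 2 = ‖∑ i, f i * star (f i)‖ := by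
    rw [CStarModule.norm_sq_eq (A := D)]; rfl
  have h3 : ‖Z‖ ^ 2 ≤ ∑ i, ‖z i‖ ^ 2 := by
    rw [CStarModule.norm_sq_eq (A := D)]
    change ‖∑ i, star (z i) * star (star (z i))‖ ≤ _
    refine (norm_sum_le _ _).trans (Finset.sum_le_sum fun i _ => ?_)
    rw [star_star, CStarRing.norm_star_mul_self, sq]
  rw [h1] at h
  calc _ ≤ (‖Z‖ * ‖F‖) ^ 2 := by gcongr
    _ = ‖F‖ ^ 2 * ‖Z‖ ^ 2 := by ring
    _ ≤ _ := by rw [h2]; gcongr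

lemma tom_chain (B : StarSubalgebra ℂ D) (E : D →ₗ[ℂ] D)
    (hE_range : ∀ x, E x ∈ B) (hE_fix : ∀ b ∈ B, E b = b) (hE_contr : ∀ x, ‖E x‖ ≤ ‖x‖)
    (r : ℕ → D) (hrB : ∀ i, r i ∈ B) (hr0 : ∀ i, 0 ≤ r i) (hr1 : ∀ i, r i ≤ 1)
    (hrr : ∀ i, r (i + 1) * r i = r (i + 1)) (hrr' : ∀ i, r (i + 1) ≤ r i)
    (N : ℕ) (x : D) :
    ‖∑ i ∈ Finset.range N, (r (i + 1) * E x - E (r (i + 1) * x))‖ ≤ 2 * Real.sqrt N * ‖x‖ := by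
  have hrs : ∀ i, star (r i) = r i := fun i => (IsSelfAdjoint.of_nonneg (hr0 i)).star_eq
  have hrrs : ∀ i, r i * r (i + 1) = r (i + 1) := fun i => by
    have := congrArg star (hrr i); simpa [hrs] using this
  have hr2 : ∀ i, r (i + 2) * r i = r (i + 2) := fun i => by
    calc r (i + 2) * r i = r (i + 2) * r (i + 1) * r i := by rw [hrr (i + 1)]
      _ = _ := by rw [mul_assoc, hrr i, hrr (i + 1)]
  have hr2s : ∀ i, r i * r (i + 2) = r (i + 2) := fun i => by
    have := congrArg star (hr2 i); simpa [hrs] using this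
  set f : ℕ → D := fun i => r i - r (i + 1) with hf
  have hfs : ∀ i, star (f i) = f i := fun i => by simp [hf, hrs]
  have hf0 : ∀ i, 0 ≤ f i := fun i => sub_nonneg.2 (hrr' i)
  have hf1 : ∀ i, f i ≤ 1 := fun i => (sub_le_self _ (hr0 _)).trans (hr1 i)
  have hfn : ∀ i, ‖f i‖ ≤ 1 := fun i => (CStarAlgebra.norm_le_one_iff_of_nonneg _ (hf0 i)).2 (hf1 i)
  have orth := tom_orth B E hE_range hE_fix hE_contr
  have hsa : ∀ i, IsSelfAdjoint (f i) := hfs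
  have hsr : ∀ i, IsSelfAdjoint (r i) := hrs
  have id1 : ∀ i, r (i + 1) * E x - E (r (i + 1) * x)
      = f (i + 1) * E (f i * x) - f i * E (f (i + 1) * x) := by
    intro i
    have o1 := orth (r (i + 1)) (1 - r i) (hrB _) (hr0 _) (hr1 _)
      ((IsSelfAdjoint.one D).sub (hsr i)) (by rw [mul_sub, hrr, mul_one, sub_self]) x
    have o2 := orth (r (i + 2)) (f i) (hrB _) (hr0 _) (hr1 _) (hsa i)
      (by simp only [hf]; rw [mul_sub, hr2, hrr, sub_self]) x
    have o3 := orth (1 - r (i + 1)) (r (i + 2)) (sub_mem (one_mem _) (hrB _))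
      (sub_nonneg.2 (hr1 _)) (sub_le_self _ (hr0 _)) (hsr _)
      (by rw [sub_mul, hrrs (i + 1), one_mul, sub_self]) x
    have o4 := orth (1 - r i) (f (i + 1)) (sub_mem (one_mem _) (hrB _))
      (sub_nonneg.2 (hr1 _)) (sub_le_self _ (hr0 _)) (hsa _)
      (by simp only [hf]; rw [sub_mul, mul_sub (r i), hrrs, hr2s, one_mul, sub_self]) x
    simp only [hf, sub_mul, one_mul, map_sub, mul_sub] at o1 o2 o3 o4 ⊢
    rw [show i + 1 + 1 = i + 2 from rfl] at *
    linear_combination (norm := abel) o1 + o2 - o4 - o3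
  have hsq : ‖∑ i : Fin N, f i * star (f i)‖ ≤ 1 ∧ ‖∑ i : Fin N, f (i + 1) * star (f (i + 1))‖ ≤ 1 := by
    have gen : ∀ m, ‖∑ i : Fin N, f (i + m) * star (f (i + m))‖ ≤ 1 := by
      intro m
      rw [CStarAlgebra.norm_le_one_iff_of_nonneg _ (Finset.sum_nonneg fun i _ => mul_star_self_nonneg _)]
      rw [Fin.sum_univ_eq_sum_range (fun i => f (i + m) * star (f (i + m)))]
      calc _ ≤ ∑ i ∈ Finset.range N, f (i + m) := by
            refine Finset.sum_le_sum fun i _ => ?_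
            rw [hfs]
            have := CStarAlgebra.pow_antitone (hf0 (i + m)) (hf1 (i + m)) (show 1 ≤ 2 by norm_num)
            simpa [sq] using this
        _ = r m - r (N + m) := by
            have := Finset.sum_range_sub' (fun i => r (i + m)) N
            simp only [hf]
            rw [zero_add] at this
            rw [← this]
            refine Finset.sum_congr rfl fun i _ => ?_
            rw [show i + m + 1 = i + 1 + m by ring]
        _ ≤ 1 := (sub_le_self _ (hr0 _)).trans (hr1 _)
    exact ⟨by simpa using gen 0, gen 1⟩
  have bd : ∀ m l : ℕ, ‖∑ i : Fin N, f (i + m) * star (f (i + m))‖ ≤ 1 →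
      ‖∑ i ∈ Finset.range N, f (i + m) * E (f (i + l) * x)‖ ≤ Real.sqrt N * ‖x‖ := by
    intro m l hm
    rw [← Fin.sum_univ_eq_sum_range (fun i => f (i + m) * E (f (i + l) * x))]
    have := row_cs (fun i : Fin N => f (i + m)) (fun i : Fin N => E (f (i + l) * x))
    have h2 : ∑ i : Fin N, ‖E (f (i + l) * x)‖ ^ 2 ≤ N * ‖x‖ ^ 2 := by
      calc _ ≤ ∑ i : Fin N, ‖x‖ ^ 2 := by
            refine Finset.sum_le_sum fun i _ => ?_
            gcongr
            refine (hE_contr _).trans ((norm_mul_le _ _).trans ?_)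
            exact mul_le_of_le_one_left (norm_nonneg _) (hfn _)
        _ = _ := by simp
    refine le_of_sq_le_sq ?_ (by positivity)
    rw [mul_pow, Real.sq_sqrt (by positivity)]
    refine this.trans ?_
    calc _ ≤ 1 * ∑ i : Fin N, ‖E (f (i + l) * x)‖ ^ 2 := by gcongr
      _ ≤ _ := by rw [one_mul]; exact h2
  simp_rw [id1, Finset.sum_sub_distrib]
  refine (norm_sub_le _ _).trans ?_
  have b1 := bd 1 0 hsq.2
  have b2 := bd 0 1 hsq.1
  simp only [add_zero] at b1 b2
  linarith

lemma clamp_sum (s : ℝ) (hs : 0 ≤ s) (M : ℕ) :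
    ∑ i ∈ Finset.range M, max 0 (min 1 (s - i)) = min s M := by
  induction M with
  | zero => simp [hs]
  | succ M ih =>
    rw [Finset.sum_range_succ, ih]; push_cast
    rcases le_total s M with h | h
    · have e1 : min 1 (s - M) = s - M := min_eq_right (by linarith)
      have e2 : max 0 (s - M) = 0 := max_eq_left (by linarith)
      have e3 : min s ((M : ℝ) + 1) = s := min_eq_left (by linarith)
      rw [min_eq_left h, e1, e2, e3]; ring
    · rw [min_eq_right h]
      rcases le_total s (M + 1) with h' | h'
      · rw [min_eq_left h', min_eq_right (by linarith), max_eq_right (by linarith)]; ring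
      · rw [min_eq_right h', min_eq_left (by linarith), max_eq_right (by linarith)]

lemma tom_pos (B : StarSubalgebra ℂ D) (hB : IsClosed (B : Set D)) (E : D →ₗ[ℂ] D)
    (hE_range : ∀ x, E x ∈ B) (hE_fix : ∀ b ∈ B, E b = b) (hE_contr : ∀ x, ‖E x‖ ≤ ‖x‖)
    (a : D) (haB : a ∈ B) (ha0 : 0 ≤ a) (ha1 : a ≤ 1) (x : D) : E (a * x) = a * E x := by
  have hsa : IsSelfAdjoint a := IsSelfAdjoint.of_nonneg ha0
  have hspec : ∀ t ∈ spectrum ℝ a, 0 ≤ t ∧ t ≤ 1 := by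
    intro t ht
    refine ⟨spectrum_nonneg_of_nonneg ha0 ht, ?_⟩
    have := (le_algebraMap_iff_spectrum_le (R := ℝ) (r := 1) (a := a)).1 (by simpa using ha1)
    exact this t ht
  have key : ∀ N : ℕ, N * ‖a * E x - E (a * x)‖ ≤ 2 * Real.sqrt N * ‖x‖ := by
    intro N
    let ρ : ℕ → ℝ → ℝ := fun i t => max 0 (min 1 (N * t + 1 - i))
    have hρc : ∀ i, Continuous (ρ i) := fun i => by fun_prop
    have h0 : ∀ i t, 0 ≤ ρ i t := fun i t => le_max_left _ _
    have h1 : ∀ i t, ρ i t ≤ 1 := fun i t => max_le zero_le_one (min_le_left _ _)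
    have hmono : ∀ i t, ρ (i + 1) t ≤ ρ i t := fun i t => by
      simp only [ρ]; push_cast; gcongr; simp
    have hmul : ∀ i t, ρ (i + 1) t * ρ i t = ρ (i + 1) t := fun i t => by
      simp only [ρ]; push_cast
      rcases le_total (N * t + 1 - (i + 1)) 0 with h | h
      · rw [max_eq_left (min_le_of_right_le h)]; simp
      · have : max 0 (min 1 ((N:ℝ) * t + 1 - i)) = 1 := by
          rw [min_eq_left (by linarith)]; simp
        rw [this, mul_one]
    have hch := tom_chain B E hE_range hE_fix hE_contr (fun i => cfc (ρ i) a)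
      (fun i => cfc_mem (S := StarSubalgebra ℂ D) (ρ i) haB)
      (fun i => cfc_nonneg (fun t _ => h0 i t))
      (fun i => cfc_le_one _ _ (fun t _ => h1 i t))
      (fun i => by
        rw [← cfc_mul (ρ (i + 1)) (ρ i) a (hρc _).continuousOn (hρc _).continuousOn]
        simp only [hmul])
      (fun i => cfc_mono (fun t _ => hmono i t) (hρc _).continuousOn (hρc _).continuousOn) N x
    have hsum : ∑ i ∈ Finset.range N, cfc (ρ (i + 1)) a = (N : ℝ) • a := by
      rw [← cfc_sum _ _ _ (fun i _ => (hρc _).continuousOn)]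
      rw [← cfc_smul_id (R := ℝ) (N : ℝ) a]
      refine cfc_congr fun t ht => ?_
      obtain ⟨ht0, ht1⟩ := hspec t ht
      have := clamp_sum (N * t) (by positivity) N
      rw [min_eq_left (by nlinarith [(Nat.cast_nonneg N : (0:ℝ) ≤ N)])] at this
      simp only [Finset.sum_apply, ρ, smul_eq_mul]
      refine Eq.trans ?_ this
      refine Finset.sum_congr rfl fun i _ => ?_
      push_cast; ring_nf
    rw [Finset.sum_sub_distrib, ← map_sum, ← Finset.sum_mul, ← Finset.sum_mul, hsum] at hch
    have e : ((N:ℝ) • a) * E x - E (((N:ℝ) • a) * x) = (N : ℂ) • (a * E x - E (a * x)) := by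
      have : ((N:ℝ) • a) = (N : ℂ) • a := by
        rw [← Complex.coe_smul]; simp
      rw [this, smul_mul_assoc, smul_mul_assoc, map_smul, smul_sub]
    rw [e, norm_smul] at hch
    simpa using hch
  have : ‖a * E x - E (a * x)‖ = 0 := by
    by_contra hne
    have hpos : 0 < ‖a * E x - E (a * x)‖ := lt_of_le_of_ne (norm_nonneg _) (Ne.symm hne)
    set q := ‖a * E x - E (a * x)‖
    obtain ⟨M, hM⟩ := exists_nat_gt (2 * ‖x‖ / q)
    have := key (M ^ 2)
    push_cast at this
    rw [Real.sqrt_sq (by positivity)] at this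
    have hM' : 2 * ‖x‖ < M * q := by rwa [div_lt_iff₀ hpos] at hM
    have hM0 : (0:ℝ) < M := lt_of_le_of_lt (by positivity) hM
    nlinarith
  exact (sub_eq_zero.1 (norm_eq_zero.1 this)).symm

end Tomiyama

section Tomiyama2

variable {D : Type*} [CStarAlgebra D]

theorem tom_left (B : StarSubalgebra ℂ D) (hB : IsClosed (B : Set D)) (E : D →ₗ[ℂ] D)
    (hE_range : ∀ x, E x ∈ B) (hE_fix : ∀ b ∈ B, E b = b) (hE_contr : ∀ x, ‖E x‖ ≤ ‖x‖)
    (b : D) (hb : b ∈ B) (x : D) : E (b * x) = b * E x := by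
  let _ := CStarAlgebra.spectralOrder D
  let _ := CStarAlgebra.spectralOrderedRing D
  have sa : ∀ b ∈ B, IsSelfAdjoint b → E (b * x) = b * E x := by
    intro b hb hbs
    set M : ℝ := ‖b‖ + 1 with hM
    have hMpos : 0 < M := by positivity
    have e1 : b ≤ algebraMap ℝ D M := by
      refine (hbs.le_algebraMap_norm_self).trans ?_
      exact algebraMap_mono D (by linarith)
    have e2 : -algebraMap ℝ D M ≤ b := by
      refine le_trans ?_ (hbs.neg_algebraMap_norm_le_self)
      exact neg_le_neg (algebraMap_mono D (by linarith))
    set a : D := (1 / (2 * M)) • (b + algebraMap ℝ D M) with ha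
    have hmem : algebraMap ℝ D M ∈ B := by
      rw [IsScalarTower.algebraMap_apply ℝ ℂ D]; exact algebraMap_mem _ _
    have haB : a ∈ B := by
      rw [ha, ← Complex.coe_smul]; exact SMulMemClass.smul_mem _ (add_mem hb hmem)
    have ha0 : 0 ≤ a := smul_nonneg (by positivity) (by
      have := sub_nonneg.2 e2; simpa using this)
    have ha1 : a ≤ 1 := by
      have : a ≤ (1 / (2 * M)) • (algebraMap ℝ D M + algebraMap ℝ D M) :=
        smul_le_smul_of_nonneg_left (by gcongr) (by positivity)
      refine this.trans (le_of_eq ?_)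
      rw [← map_add, Algebra.smul_def, ← map_mul]
      rw [show 1 / (2 * M) * (M + M) = 1 by field_simp; ring, map_one]
    have h := tom_pos B hB E hE_range hE_fix hE_contr a haB ha0 ha1 x
    have hba : b = (2 * M : ℂ) • a - (M : ℂ) • 1 := by
      rw [ha, ← Complex.coe_smul, smul_smul, Algebra.algebraMap_eq_smul_one, ← Complex.coe_smul]
      have : (2 * (M:ℂ)) * ((1 / (2 * M) : ℝ) : ℂ) = 1 := by
        push_cast
        have : (M : ℂ) ≠ 0 := by exact_mod_cast hMpos.ne'
        field_simp
      rw [this, one_smul]; simp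
    clear_value a
    rw [hba, sub_mul, sub_mul, smul_mul_assoc, smul_mul_assoc, smul_mul_assoc, smul_mul_assoc,
      map_sub, map_smul, map_smul, h, one_mul, one_mul]
  have hr : ((realPart b : selfAdjoint D) : D) ∈ B := by
    rw [realPart_apply_coe, ← Complex.coe_smul]
    exact SMulMemClass.smul_mem _ (add_mem hb (star_mem hb))
  have hi : ((imaginaryPart b : selfAdjoint D) : D) ∈ B := by
    rw [imaginaryPart_apply_coe, ← Complex.coe_smul]
    exact SMulMemClass.smul_mem _ (SMulMemClass.smul_mem _ (sub_mem hb (star_mem hb)))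
  have h1 := sa _ hr (realPart b).2
  have h2 := sa _ hi (imaginaryPart b).2
  rw [← realPart_add_I_smul_imaginaryPart b, add_mul, add_mul, smul_mul_assoc, smul_mul_assoc,
    map_add, map_smul, h1, h2]

theorem tom_right (B : StarSubalgebra ℂ D) (hB : IsClosed (B : Set D)) (E : D →ₗ[ℂ] D)
    (hE_range : ∀ x, E x ∈ B) (hE_fix : ∀ b ∈ B, E b = b) (hE_contr : ∀ x, ‖E x‖ ≤ ‖x‖)
    (b : D) (hb : b ∈ B) (x : D) : E (x * b) = E x * b := by
  let E' : D →ₗ[ℂ] D :=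
    { toFun := fun x => star (E (star x))
      map_add' := fun x y => by simp
      map_smul' := fun c x => by simp }
  have h := tom_left B hB E' (fun x => star_mem (hE_range _))
    (fun b hb => by change star (E (star b)) = b; rw [hE_fix _ (star_mem hb), star_star])
    (fun x => by change ‖star (E (star x))‖ ≤ _; rw [norm_star]; simpa using hE_contr (star x))
    (star b) (star_mem hb) (star x)
  change star (E (star (star b * star x))) = star b * star (E (star (star x))) at h
  have := congrArg star h
  simpa using this

end Tomiyama2


section Avg

variable {D : Type*} [CStarAlgebra D] {G : Type*}

/-- The average of a `D`-valued function over a finite set. -/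
noncomputable def avg (F : Finset G) (f : G → D) : D := ((F.card : ℂ))⁻¹ • ∑ h ∈ F, f h

lemma avg_const {F : Finset G} (hF : F.Nonempty) (a : D) : avg F (fun _ => a) = a := by
  have : (F.card : ℂ) ≠ 0 := by exact_mod_cast hF.card_pos.ne'
  rw [avg, Finset.sum_const, ← Nat.cast_smul_eq_nsmul ℂ, smul_smul, inv_mul_cancel₀ this, one_smul]

lemma avg_sub (F : Finset G) (f g : G → D) : avg F f - avg F g = avg F (fun h => f h - g h) := by
  simp [avg, Finset.sum_sub_distrib, smul_sub]

lemma avg_mul (F : Finset G) (f : G → D) (a : D) : avg F f * a = avg F (fun h => f h * a) := by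
  simp [avg, Finset.sum_mul]

lemma mul_avg (F : Finset G) (f : G → D) (a : D) : a * avg F f = avg F (fun h => a * f h) := by
  simp [avg, Finset.mul_sum]

lemma star_avg (F : Finset G) (f : G → D) : star (avg F f) = avg F (fun h => star (f h)) := by
  simp [avg, star_smul, star_sum]

lemma avg_mem (S : StarSubalgebra ℂ D) (F : Finset G) (f : G → D) (hf : ∀ h, f h ∈ S) :
    avg F f ∈ S := SMulMemClass.smul_mem _ (sum_mem fun h _ => hf h)

lemma avg_norm_le {F : Finset G} (hF : F.Nonempty) {f : G → D} {M : ℝ}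
    (hM : ∀ h ∈ F, ‖f h‖ ≤ M) : ‖avg F f‖ ≤ M := by
  have hc : (0 : ℝ) < F.card := by exact_mod_cast hF.card_pos
  rw [avg, norm_smul, norm_inv, Complex.norm_natCast, inv_mul_le_iff₀ hc]
  refine (norm_sum_le _ _).trans ((Finset.sum_le_sum hM).trans ?_)
  simp

lemma avg_congr {F : Finset G} {f g : G → D} (h : ∀ x ∈ F, f x = g x) : avg F f = avg F g := by
  rw [avg, avg, Finset.sum_congr rfl h]

lemma avg_dist_le {F : Finset G} (hF : F.Nonempty) {f g : G → D} {M : ℝ}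
    (hM : ∀ h ∈ F, ‖f h - g h‖ ≤ M) : ‖avg F f - avg F g‖ ≤ M := by
  rw [avg_sub]; exact avg_norm_le hF hM

lemma avg_sub_const_le {F : Finset G} (hF : F.Nonempty) {f : G → D} {a : D} {M : ℝ}
    (hM : ∀ h ∈ F, ‖f h - a‖ ≤ M) : ‖avg F f - a‖ ≤ M := by
  have := avg_dist_le hF (g := fun _ => a) hM
  rwa [avg_const hF] at this

lemma avg_mul_avg {F : Finset G} (hF : F.Nonempty) {f g : G → D} {a b : D} {M N : ℝ}
    (hM : ∀ h ∈ F, ‖f h - a‖ ≤ M) (hN : ∀ h ∈ F, ‖g h - b‖ ≤ N) :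
    ‖avg F (fun h => f h * g h) - avg F f * avg F g‖ ≤ 2 * (M * N) := by
  have hM0 : 0 ≤ M := by obtain ⟨h, hh⟩ := hF; exact (norm_nonneg _).trans (hM h hh)
  have e : avg F (fun h => f h * g h) - avg F f * avg F g
      = avg F (fun h => (f h - a) * (g h - b)) - (avg F f - a) * (avg F g - b) := by
    have e1 : avg F (fun h => (f h - a) * (g h - b))
        = avg F (fun h => f h * g h) - avg F f * b - (a * avg F g - a * b) := by
      rw [avg_mul, mul_avg]
      conv_rhs => rw [← avg_const hF (a * b)]
      simp only [avg_sub]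
      refine avg_congr fun h _ => ?_
      noncomm_ring
    rw [e1]; noncomm_ring
  rw [e]
  have h1 : ‖avg F (fun h => (f h - a) * (g h - b))‖ ≤ M * N :=
    avg_norm_le hF fun h hh => (norm_mul_le _ _).trans
      (mul_le_mul (hM h hh) (hN h hh) (norm_nonneg _) hM0)
  have h2 : ‖(avg F f - a) * (avg F g - b)‖ ≤ M * N :=
    (norm_mul_le _ _).trans (mul_le_mul (avg_sub_const_le hF hM) (avg_sub_const_le hF hN)
      (norm_nonneg _) hM0)
  linarith [norm_sub_le (avg F (fun h => (f h - a) * (g h - b))) ((avg F f - a) * (avg F g - b))]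

lemma folner_avg [Group G] (hG : FolnerAmenable G) (T : Finset G) (ε : ℝ) (hε : 0 < ε) :
    ∃ F : Finset G, F.Nonempty ∧ ∀ g ∈ T, ∀ (f : G → D) (M : ℝ), (∀ h, ‖f h‖ ≤ M) →
      ‖avg F (fun h => f (g * h)) - avg F f‖ ≤ ε * M := by
  classical
  obtain ⟨F, hF, h⟩ := hG T ε hε
  refine ⟨F, hF, fun g hg f M hM => ?_⟩
  have hc : (0 : ℝ) < F.card := by exact_mod_cast hF.card_pos
  have h1 : ((symmDiff (F.image (fun x => g * x)) F).card : ℝ) < ε * F.card := by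
    convert h g hg
  have hM0 : 0 ≤ M := (norm_nonneg _).trans (hM 1)
  set F' := F.image (fun x => g * x) with hF'
  have e1 : ∑ h ∈ F, f (g * h) = ∑ h ∈ F', f h := by
    rw [hF', Finset.sum_image]
    intro x _ y _ hxy; simpa using hxy
  have e2 : ∑ h ∈ F', f h - ∑ h ∈ F, f h = ∑ h ∈ F' \ F, f h - ∑ h ∈ F \ F', f h := by
    rw [Finset.sum_sdiff_sub_sum_sdiff]
  have e3 : ‖∑ h ∈ F' \ F, f h - ∑ h ∈ F \ F', f h‖ ≤ (symmDiff F' F).card * M := by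
    have hd : Disjoint (F' \ F) (F \ F') := disjoint_sdiff_sdiff
    have hcard : (symmDiff F' F).card = (F' \ F).card + (F \ F').card := by
      rw [← Finset.card_union_of_disjoint hd]; rfl
    rw [hcard]; push_cast; rw [add_mul]
    refine (norm_sub_le _ _).trans (add_le_add ?_ ?_) <;>
    · refine (norm_sum_le _ _).trans ((Finset.sum_le_sum fun h _ => hM h).trans ?_)
      simp
  rw [avg, avg, ← smul_sub, e1, e2, norm_smul, norm_inv, Complex.norm_natCast,
    inv_mul_le_iff₀ hc]
  refine e3.trans ?_
  nlinarith

end Avg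

section Stage1

variable {D : Type*} [CStarAlgebra D] {G : Type*} [Group G]

/-- The element of `D` given by a group element. -/
def vv (ι : G →* unitary D) (g : G) : D := ((ι g : unitary D) : D)

variable (ι : G →* unitary D)

@[simp] lemma vv_one : vv ι 1 = 1 := by simp [vv]
lemma vv_mul (g h : G) : vv ι (g * h) = vv ι g * vv ι h := by simp [vv]
@[simp] lemma star_vv_mul (g : G) : star (vv ι g) * vv ι g = 1 := by simp [vv]
@[simp] lemma vv_mul_star (g : G) : vv ι g * star (vv ι g) = 1 := by simp [vv]
lemma star_vv (g : G) : star (vv ι g) = vv ι g⁻¹ := by simp only [vv, map_inv]; rfl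
lemma norm_le_one_of_unitary {u : D} (hu : star u * u = 1) : ‖u‖ ≤ 1 := by
  have h1 := CStarRing.norm_star_mul_self (x := u)
  rw [hu] at h1
  have h2 : ‖(1 : D)‖ ≤ 1 := by
    rcases subsingleton_or_nontrivial D with h | h
    · rw [Subsingleton.elim (1 : D) 0]; simp
    · exact (CStarRing.norm_one).le
  nlinarith [norm_nonneg u]
lemma norm_one_le : ‖(1 : D)‖ ≤ 1 := norm_le_one_of_unitary (by simp)
lemma vv_norm (g : G) : ‖vv ι g‖ ≤ 1 := norm_le_one_of_unitary (star_vv_mul ι g)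
lemma mul_vv_norm (x : D) (g : G) : ‖x * vv ι g‖ ≤ ‖x‖ :=
  (norm_mul_le _ _).trans (mul_le_of_le_one_right (norm_nonneg _) (vv_norm ι g))

/-- Unital `C`-bimodule maps with values in `B`, close to the identity on `A`. -/
structure PB (A B C : StarSubalgebra ℂ D) (η : ℝ) (θ : D →ₗ[ℂ] D) : Prop where
  range : ∀ x, θ x ∈ B
  left : ∀ c ∈ C, ∀ x, θ (c * x) = c * θ x
  right : ∀ c ∈ C, ∀ x, θ (x * c) = θ x * c
  one : θ 1 = 1
  near : ∀ x ∈ A, ‖θ x - x‖ ≤ η * ‖x‖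

/-- `θ` is `ε`-multiplicative for right multiplication by `K`. -/
def MulDef (A : StarSubalgebra ℂ D) (θ : D →ₗ[ℂ] D) (K : Finset G) (ε : ℝ) : Prop :=
  ∀ x ∈ A, ∀ k ∈ K, ‖θ (x * vv ι k) - θ x * θ (vv ι k)‖ ≤ ε * ‖x‖

variable {A B C : StarSubalgebra ℂ D} {η : ℝ} {θ : D →ₗ[ℂ] D}

lemma PB.mono (h : PB A B C η θ) {η' : ℝ} (hη : η ≤ η') : PB A B C η' θ :=
  { h with near := fun x hx => (h.near x hx).trans (by gcongr) }

lemma PB.norm_le (h : PB A B C η θ) {x : D} (hx : x ∈ A) : ‖θ x‖ ≤ (1 + η) * ‖x‖ := by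
  have := h.near x hx
  have h2 := norm_add_le (θ x - x) x
  rw [sub_add_cancel] at h2
  linarith

lemma PB.fix (h : PB A B C η θ) {c : D} (hc : c ∈ C) : θ c = c := by
  have := h.left c hc 1
  rwa [h.one, mul_one] at this

lemma exists_inv (hB : IsClosed (B : Set D)) {b u : D} (hb : b ∈ B)
    (hu : star u * u = 1) (hu' : u * star u = 1) (hη : η < 1) (h : ‖b - u‖ ≤ η) :
    ∃ w ∈ B, b * w = 1 ∧ w * b = 1 ∧ ‖w‖ ≤ 1 / (1 - η) := by
  have hun : ‖star u‖ ≤ 1 := norm_le_one_of_unitary (by simpa using hu')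
  have h1 : IsUnit (b * star u) := by
    have : ‖1 - b * star u‖ < 1 := by
      have e : 1 - b * star u = -((b - u) * star u) := by rw [sub_mul, hu']; abel
      rw [e, norm_neg]
      refine lt_of_le_of_lt ((norm_mul_le _ _).trans ?_) hη
      exact (mul_le_of_le_one_right (norm_nonneg _) hun).trans h
    simpa using isUnit_one_sub_of_norm_lt_one this
  have hU : IsUnit u := ⟨⟨u, star u, hu', hu⟩, rfl⟩
  have h2 : IsUnit b := by
    have := h1.mul hU
    rwa [mul_assoc, hu, mul_one] at this
  have h3 : IsUnit (⟨b, hb⟩ : B) := by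
    have : IsClosed (B : Set D) := hB
    exact (StarSubalgebra.coe_isUnit B).1 h2
  obtain ⟨⟨b', w, hbw, hwb⟩, rfl : b' = _⟩ := h3
  have hbw' : b * (w : D) = 1 := congrArg Subtype.val hbw
  have hwb' : (w : D) * b = 1 := congrArg Subtype.val hwb
  refine ⟨w, w.2, hbw', hwb', ?_⟩
  have e : (w : D) = star u - w * ((b - u) * star u) := by
    rw [sub_mul, mul_sub, ← mul_assoc, hwb', hu']; simp
  have h4 : ‖(w : D)‖ ≤ 1 + ‖(w : D)‖ * η := by
    calc ‖(w : D)‖ = ‖star u - w * ((b - u) * star u)‖ := by rw [← e]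
      _ ≤ ‖star u‖ + ‖(w : D) * ((b - u) * star u)‖ := norm_sub_le _ _
      _ ≤ 1 + ‖(w : D)‖ * η := by
        refine add_le_add hun ((norm_mul_le _ _).trans ?_)
        gcongr
        refine (norm_mul_le _ _).trans ?_
        exact (mul_le_of_le_one_right (norm_nonneg _) hun).trans h
  rw [le_div_iff₀ (by linarith)]
  linarith

/-- The averaged map. -/
noncomputable def avgMap (θ : D →ₗ[ℂ] D) (F : Finset G) (w : G → D) : D →ₗ[ℂ] D :=
  ((F.card : ℂ))⁻¹ • ∑ h ∈ F,
    (LinearMap.mulRight ℂ (w h)) ∘ₗ θ ∘ₗ (LinearMap.mulRight ℂ (vv ι h))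

lemma avgMap_apply (θ : D →ₗ[ℂ] D) (F : Finset G) (w : G → D) (x : D) :
    avgMap ι θ F w x = avg F (fun h => θ (x * vv ι h) * w h) := by
  simp [avgMap, avg]

lemma stage1_step (hG : FolnerAmenable G) (hB : IsClosed (B : Set D)) (hCA : C ≤ A) (hCB : C ≤ B)
    (hA : ∀ g, vv ι g ∈ A)
    (hn : ∀ g, ∀ c ∈ C, star (vv ι g) * c * vv ι g ∈ C)
    {η ε τ : ℝ} (hτ : 0 < τ) (hε : 0 ≤ ε) (hη0 : 0 ≤ η) (hη : η ≤ 1 / 100)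
    (hyp : ∀ K : Finset G, ∃ θ : D →ₗ[ℂ] D, PB A B C η θ ∧ MulDef ι A θ K ε) :
    ∀ K : Finset G, ∃ θ : D →ₗ[ℂ] D, PB A B C (min (η + 1.02 * ε) (2.04 * η)) θ ∧
      MulDef ι A θ K (2.1 * ε ^ 2 + 4 * τ) := by
  classical
  intro K
  obtain ⟨F, hF, hFK⟩ := folner_avg (D := D) hG K τ hτ
  obtain ⟨θ, hθ, hdef⟩ := hyp (F ∪ K ∪ Finset.image₂ (· * ·) K F)
  have hinv : ∀ h, ∃ w ∈ B, θ (vv ι h) * w = 1 ∧ w * θ (vv ι h) = 1 ∧ ‖w‖ ≤ 1.02 := by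
    intro h
    obtain ⟨w, hw, h1, h2, h3⟩ := exists_inv hB (hθ.range (vv ι h)) (star_vv_mul ι h)
      (vv_mul_star ι h) (show η < 1 by linarith) ((hθ.near _ (hA h)).trans
        (mul_le_of_le_one_right hη0 (vv_norm ι h)))
    refine ⟨w, hw, h1, h2, h3.trans ?_⟩
    rw [div_le_iff₀ (by linarith)]; linarith
  choose w hwB hw1 hw2 hw3 using hinv
  have hxA : ∀ x ∈ A, ∀ h, x * vv ι h ∈ A := fun x hx h => mul_mem hx (hA h)
  have bdd : ∀ x ∈ A, ∀ h, ‖θ (x * vv ι h) * w h‖ ≤ 2 * ‖x‖ := by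
    intro x hx h
    have h1 := hθ.norm_le (hxA x hx h)
    have h2 := mul_vv_norm ι x h
    have h4 : ‖θ (x * vv ι h)‖ ≤ 1.01 * ‖x‖ := by nlinarith [norm_nonneg x]
    refine (norm_mul_le _ _).trans ?_
    have := mul_le_mul h4 (hw3 h) (norm_nonneg _) (by positivity)
    linarith [norm_nonneg x]
  -- the difference from `θ x`
  have dev : ∀ x ∈ A, ∀ h ∈ F ∪ K ∪ Finset.image₂ (· * ·) K F,
      ‖θ (x * vv ι h) * w h - θ x‖ ≤ (1.02 * ε) * ‖x‖ := by
    intro x hx h hh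
    have e : θ (x * vv ι h) * w h - θ x = (θ (x * vv ι h) - θ x * θ (vv ι h)) * w h := by
      rw [sub_mul, mul_assoc (θ x), hw1, mul_one]
    rw [e]
    refine (norm_mul_le _ _).trans ?_
    have := mul_le_mul (hdef x hx h hh) (hw3 h) (norm_nonneg _) (by positivity)
    linarith
  have dev2 : ∀ x ∈ A, ∀ h, ‖θ (x * vv ι h) * w h - x‖ ≤ (2.04 * η) * ‖x‖ := by
    intro x hx h
    have e : θ (x * vv ι h) * w h - x
        = ((θ (x * vv ι h) - x * vv ι h) - x * (θ (vv ι h) - vv ι h)) * w h := by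
      rw [mul_sub, sub_sub_sub_cancel_right, sub_mul, mul_assoc x, hw1, mul_one]
    rw [e]
    refine (norm_mul_le _ _).trans ?_
    have h1 : ‖(θ (x * vv ι h) - x * vv ι h) - x * (θ (vv ι h) - vv ι h)‖ ≤ 2 * η * ‖x‖ := by
      have a1 := (hθ.near _ (hxA x hx h)).trans
        (mul_le_mul_of_nonneg_left (mul_vv_norm ι x h) hη0)
      have a2 := (hθ.near _ (hA h)).trans (mul_le_of_le_one_right hη0 (vv_norm ι h))
      have a3 : ‖x * (θ (vv ι h) - vv ι h)‖ ≤ ‖x‖ * η :=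
        (norm_mul_le _ _).trans (by gcongr)
      linarith [norm_sub_le (θ (x * vv ι h) - x * vv ι h) (x * (θ (vv ι h) - vv ι h))]
    have := mul_le_mul h1 (hw3 h) (norm_nonneg _) (by positivity)
    linarith
  refine ⟨avgMap ι θ F w, ⟨?_, ?_, ?_, ?_, ?_⟩, ?_⟩
  · intro x; rw [avgMap_apply]
    exact avg_mem _ _ _ fun h => mul_mem (hθ.range _) (hwB h)
  · intro c hc x
    rw [avgMap_apply, avgMap_apply, mul_avg]
    refine avg_congr fun h _ => ?_
    rw [mul_assoc c, hθ.left c hc, mul_assoc]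
  · intro c hc x
    rw [avgMap_apply, avgMap_apply, avg_mul]
    refine avg_congr fun h _ => ?_
    set c' := star (vv ι h) * c * vv ι h with hc'
    have hc'C : c' ∈ C := hn h c hc
    have e0 : c * vv ι h = vv ι h * c' := by
      rw [hc', ← mul_assoc, ← mul_assoc, vv_mul_star, one_mul]
    have e1 : c * θ (vv ι h) = θ (vv ι h) * c' := by
      rw [← hθ.left c hc, e0, hθ.right c' hc'C]
    have e2 : w h * c = c' * w h := by
      calc w h * c = w h * (c * θ (vv ι h)) * w h := by
            rw [mul_assoc, mul_assoc c, hw1, mul_one]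
        _ = c' * w h := by rw [e1, ← mul_assoc, hw2, one_mul]
    rw [mul_assoc x, e0, ← mul_assoc, hθ.right c' hc'C, mul_assoc, ← e2, mul_assoc]
  · rw [avgMap_apply]
    refine Eq.trans (avg_congr fun h _ => ?_) (avg_const hF 1)
    rw [one_mul, hw1]
  · intro x hx
    rw [avgMap_apply]
    rw [min_mul_of_nonneg _ _ (norm_nonneg x)]
    refine le_min ?_ (avg_sub_const_le hF fun h _ => dev2 x hx h)
    have h1 := avg_sub_const_le hF fun h hh => dev x hx h (by simp [hh])
    have h2 := hθ.near x hx
    have h3 := norm_sub_le_norm_sub_add_norm_sub (avg F (fun h => θ (x * vv ι h) * w h)) (θ x) x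
    linarith
  · intro x hx k hk
    set P : G → D := fun h => θ (x * vv ι h) * w h with hP
    set Q : G → D := fun h => θ (vv ι k * vv ι h) * w h with hQ
    have e1 : avgMap ι θ F w (x * vv ι k) = avg F (fun h => P (k * h) * Q h) := by
      rw [avgMap_apply]
      refine avg_congr fun h _ => ?_
      simp only [hP, hQ, vv_mul]
      rw [← vv_mul, mul_assoc (θ _) (w (k * h)), ← mul_assoc (w (k * h)), hw2, one_mul, vv_mul,
        mul_assoc]
    have e2 : avgMap ι θ F w x = avg F P := avgMap_apply _ _ _ _ _
    have e3 : avgMap ι θ F w (vv ι k) = avg F Q := avgMap_apply _ _ _ _ _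
    rw [e1, e2, e3]
    have f1 := hFK k hk P (2 * ‖x‖) (bdd x hx)
    have f2 : ‖avg F Q‖ ≤ 2 := avg_norm_le hF fun h _ =>
      (bdd _ (hA k) h).trans (by linarith [vv_norm ι k])
    have f3 := avg_mul_avg hF (f := fun h => P (k * h)) (g := Q) (a := θ x) (b := θ (vv ι k))
      (M := (1.02 * ε) * ‖x‖) (N := 1.02 * ε)
      (fun h hh => dev x hx (k * h) (by
        simp only [Finset.mem_union]
        exact Or.inr (Finset.mem_image₂_of_mem hk hh)))
      (fun h hh => (dev _ (hA k) h (by simp [hh])).trans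
        (mul_le_of_le_one_right (by positivity) (vv_norm ι k)))
    have f4 : ‖(avg F (fun h => P (k * h)) - avg F P) * avg F Q‖ ≤ τ * (2 * ‖x‖) * 2 :=
      (norm_mul_le _ _).trans (mul_le_mul f1 f2 (norm_nonneg _) (by positivity))
    have e4 : avg F (fun h => P (k * h) * Q h) - avg F P * avg F Q
        = (avg F (fun h => P (k * h) * Q h) - avg F (fun h => P (k * h)) * avg F Q)
          + (avg F (fun h => P (k * h)) - avg F P) * avg F Q := by noncomm_ring
    rw [e4]
    refine (norm_add_le _ _).trans ?_
    nlinarith [mul_nonneg (sq_nonneg ε) (norm_nonneg x)]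

lemma stage1 (hG : FolnerAmenable G) (hB : IsClosed (B : Set D)) (hCA : C ≤ A) (hCB : C ≤ B)
    (hA : ∀ g, vv ι g ∈ A)
    (hn : ∀ g, ∀ c ∈ C, star (vv ι g) * c * vv ι g ∈ C)
    {γ : ℝ} (hγ0 : 0 < γ) (hγ : γ < 1 / 1000) (hθ : PB A B C (2 * γ) θ)
    (ε : ℝ) (hε : 0 < ε) :
    ∀ K : Finset G, ∃ θ : D →ₗ[ℂ] D, PB A B C (4.3 * γ) θ ∧ MulDef ι A θ K ε := by
  have h0 : ∀ K : Finset G, ∃ θ : D →ₗ[ℂ] D, PB A B C (2 * γ) θ ∧ MulDef ι A θ K (6.1 * γ) := by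
    refine fun K => ⟨θ, hθ, fun x hx k _ => ?_⟩
    have a1 := (hθ.near _ (mul_mem hx (hA k))).trans
        (mul_le_mul_of_nonneg_left (mul_vv_norm ι x k) (by positivity))
    have a2 := (hθ.near _ (hA k)).trans (mul_le_of_le_one_right (by positivity) (vv_norm ι k))
    have a3 := hθ.near x hx
    have a4 : ‖θ (vv ι k)‖ ≤ 1 + 2 * γ := (hθ.norm_le (hA k)).trans
      (mul_le_of_le_one_right (by positivity) (vv_norm ι k))
    have b1 : ‖x * (θ (vv ι k) - vv ι k)‖ ≤ ‖x‖ * (2 * γ) := (norm_mul_le _ _).trans (by gcongr)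
    have b2 : ‖(θ x - x) * θ (vv ι k)‖ ≤ (2 * γ * ‖x‖) * (1 + 2 * γ) :=
      (norm_mul_le _ _).trans (by gcongr)
    have e : θ (x * vv ι k) - θ x * θ (vv ι k)
        = (θ (x * vv ι k) - x * vv ι k) - x * (θ (vv ι k) - vv ι k) - (θ x - x) * θ (vv ι k) := by
      noncomm_ring
    rw [e]
    have t1 := norm_sub_le ((θ (x * vv ι k) - x * vv ι k) - x * (θ (vv ι k) - vv ι k))
      ((θ x - x) * θ (vv ι k))
    have t2 := norm_sub_le (θ (x * vv ι k) - x * vv ι k) (x * (θ (vv ι k) - vv ι k))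
    have : γ * (γ * ‖x‖) ≤ 1 / 1000 * (γ * ‖x‖) := by gcongr
    nlinarith [mul_nonneg hγ0.le (norm_nonneg x)]
  have mono : ∀ {θ : D →ₗ[ℂ] D} {K : Finset G} {a b : ℝ}, a ≤ b → MulDef ι A θ K a →
      MulDef ι A θ K b := fun hab h x hx k hk => (h x hx k hk).trans (by gcongr)
  have h1 : ∀ n : ℕ, ∀ K : Finset G, ∃ θ : D →ₗ[ℂ] D,
      PB A B C (4.3 * γ - 2.1 * (0.1 * γ / 2 ^ n)) θ ∧ MulDef ι A θ K (0.1 * γ / 2 ^ n) := by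
    intro n
    induction n with
    | zero =>
      intro K
      obtain ⟨θ, hp, hd⟩ := stage1_step ι hG hB hCA hCB hA hn (τ := γ / 200) (by positivity)
        (by positivity) (by positivity) (by linarith) h0 K
      refine ⟨θ, hp.mono ((min_le_right _ _).trans ?_), mono ?_ hd⟩
      · norm_num; nlinarith
      · norm_num; nlinarith
    | succ n ih =>
      intro K
      set e := 0.1 * γ / 2 ^ n with he
      have hepos : 0 < e := by positivity
      have hele : e ≤ 0.1 * γ := div_le_self (by positivity) (one_le_pow₀ (by norm_num))
      have he' : 0.1 * γ / 2 ^ (n + 1) = e / 2 := by rw [he, pow_succ]; field_simp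
      obtain ⟨θ, hp, hd⟩ := stage1_step ι hG hB hCA hCB hA hn (τ := e / 100) (by positivity)
        hepos.le (by nlinarith) (by nlinarith) ih K
      rw [he']
      refine ⟨θ, hp.mono ((min_le_left _ _).trans ?_), mono ?_ hd⟩
      · nlinarith
      · nlinarith
  intro K
  obtain ⟨n, hn'⟩ := exists_nat_gt (0.1 * γ / ε)
  obtain ⟨θ, hp, hd⟩ := h1 n K
  refine ⟨θ, hp.mono ?_, mono ?_ hd⟩
  · have : 0 < 0.1 * γ / 2 ^ n := by positivity
    linarith
  · rw [div_le_iff₀ (by positivity)]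
    rw [div_lt_iff₀ hε] at hn'
    have : (n : ℝ) ≤ 2 ^ n := by exact_mod_cast (Nat.lt_two_pow_self (n := n)).le
    nlinarith

end Stage1


section Stage2

variable {D : Type*} [CStarAlgebra D]

lemma sqrt_lemma {B C : StarSubalgebra ℂ D} (hB : IsClosed (B : Set D)) {T : D} (hT : T ∈ B)
    (hTs : star T = T) (hTC : ∀ c ∈ C, c * T = T * c) {τ : ℝ} (hτ : ‖T - 1‖ ≤ τ)
    (hτ1 : τ ≤ 1 / 10) :
    ∃ R ∈ B, ∃ S ∈ B, star R = R ∧ star S = S ∧ R * R = T ∧ R * S = 1 ∧ S * R = 1 ∧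
      (∀ c ∈ C, c * R = R * c) ∧ (∀ c ∈ C, c * S = S * c) ∧ ‖R - 1‖ ≤ 0.52 * τ ∧
      ‖S‖ ≤ 1 / (1 - 0.52 * τ) := by
  have hτ0 : 0 ≤ τ := (norm_nonneg _).trans hτ
  have hsa : IsSelfAdjoint T := hTs
  have hsp : ∀ t ∈ spectrum ℝ T, |t - 1| ≤ τ := by
    intro t ht
    have h1 : t - 1 ∈ spectrum ℝ (T - algebraMap ℝ D 1) := by
      rw [← spectrum.sub_singleton_eq]
      exact Set.sub_mem_sub ht rfl
    rw [map_one] at h1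
    have h2 := spectrum.norm_le_norm_mul_of_mem h1
    refine le_trans h2 ((mul_le_of_le_one_right (norm_nonneg _) norm_one_le).trans hτ)
  have hcont : ContinuousOn Real.sqrt (spectrum ℝ T) := Real.continuous_sqrt.continuousOn
  set R := cfc Real.sqrt T with hR
  have hRB : R ∈ B := by
    have : IsClosed (B : Set D) := hB
    exact cfc_mem (S := StarSubalgebra ℂ D) Real.sqrt hT
  have hRs : star R = R := (cfc_predicate (R := ℝ) Real.sqrt T : IsSelfAdjoint R)
  have hRR : R * R = T := by
    rw [hR, ← cfc_mul Real.sqrt Real.sqrt T hcont hcont]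
    conv_rhs => rw [← cfc_id (R := ℝ) T]
    refine cfc_congr fun t ht => ?_
    have := abs_le.1 (hsp t ht)
    exact Real.mul_self_sqrt (by linarith)
  have hRC : ∀ c ∈ C, c * R = R * c := fun c hc =>
    ((Commute.cfc_real (show Commute T c from (hTC c hc).symm) Real.sqrt).symm : Commute c R)
  have hR1 : ‖R - 1‖ ≤ 0.52 * τ := by
    rw [hR, ← cfc_one ℝ T, ← cfc_sub Real.sqrt 1 T hcont continuousOn_const]
    refine norm_cfc_le (by positivity) fun t ht => ?_
    have h1 := hsp t ht
    have h2 := abs_le.1 h1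
    have h3 : (0.94 : ℝ) ≤ Real.sqrt t := Real.le_sqrt_of_sq_le (by norm_num1 at *; linarith)
    have h4 : (Real.sqrt t - 1) * (Real.sqrt t + 1) = t - 1 := by
      ring_nf; rw [Real.sq_sqrt (by linarith)]
    have h5 : |Real.sqrt t - 1| * (Real.sqrt t + 1) = |t - 1| := by
      rw [← h4, abs_mul, abs_of_nonneg (a := Real.sqrt t + 1) (by linarith)]
    rw [Real.norm_eq_abs]
    simp only [Pi.one_apply]
    nlinarith [abs_nonneg (Real.sqrt t - 1)]
  obtain ⟨S, hSB, h1, h2, h3⟩ := exists_inv hB hRB (u := 1) (by simp) (by simp)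
    (show 0.52 * τ < 1 by linarith) hR1
  refine ⟨R, hRB, S, hSB, hRs, ?_, hRR, h1, h2, hRC, ?_, hR1, h3⟩
  · have e : star S * R = 1 := by
      have := congrArg star h1
      rwa [star_mul, hRs, star_one] at this
    calc star S = star S * (R * S) := by rw [h1, mul_one]
      _ = S := by rw [← mul_assoc, e, one_mul]
  · intro c hc
    calc c * S = S * R * c * S := by rw [h2, one_mul]
      _ = S * (c * R) * S := by rw [hRC c hc, mul_assoc S R c]
      _ = S * c := by rw [mul_assoc, mul_assoc c, h1, mul_one]

variable {G : Type*} [Group G] (ι : G →* unitary D) {A B C : StarSubalgebra ℂ D}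

/-- Approximately unitary on `K`. -/
def UnDef (θ : D →ₗ[ℂ] D) (K : Finset G) (ε : ℝ) : Prop :=
  ∀ k ∈ K, ‖star (θ (vv ι k)) * θ (vv ι k) - 1‖ ≤ ε

/-- The maps used in the intertwining argument. -/
structure Good (A B C : StarSubalgebra ℂ D) (η : ℝ) (K : Finset G) (ε : ℝ) (θ : D →ₗ[ℂ] D) :
    Prop extends PB A B C η θ where
  md : MulDef ι A θ K ε
  ud : UnDef ι θ K ε

lemma Good.anti {η ε ε' : ℝ} {K K' : Finset G} {θ : D →ₗ[ℂ] D} (h : Good ι A B C η K' ε' θ)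
    (hK : K ⊆ K') (hε : ε' ≤ ε) : Good ι A B C η K ε θ :=
  { h with
    md := fun x hx k hk => (h.md x hx k (hK hk)).trans (by gcongr)
    ud := fun k hk => (h.ud k (hK hk)).trans hε }

lemma PB.vnear {η : ℝ} {θ : D →ₗ[ℂ] D} (h : PB A B C η θ) (hη : 0 ≤ η) (hA : ∀ g, vv ι g ∈ A)
    (g : G) : ‖θ (vv ι g) - vv ι g‖ ≤ η :=
  (h.near _ (hA g)).trans (mul_le_of_le_one_right hη (vv_norm ι g))

lemma PB.vnorm {η : ℝ} {θ : D →ₗ[ℂ] D} (h : PB A B C η θ) (hη : 0 ≤ η) (hA : ∀ g, vv ι g ∈ A)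
    (g : G) : ‖θ (vv ι g)‖ ≤ 1 + η :=
  (h.norm_le (hA g)).trans (mul_le_of_le_one_right (by linarith) (vv_norm ι g))

lemma PB.swap {η : ℝ} {θ : D →ₗ[ℂ] D} (h : PB A B C η θ)
    (hn : ∀ g, ∀ c ∈ C, star (vv ι g) * c * vv ι g ∈ C) (g : G) {c : D} (hc : c ∈ C) :
    c * θ (vv ι g) = θ (vv ι g) * (star (vv ι g) * c * vv ι g) := by
  rw [← h.left c hc, ← h.right _ (hn g c hc), ← mul_assoc, ← mul_assoc, vv_mul_star, one_mul]

lemma PB.swap_star {η : ℝ} {θ : D →ₗ[ℂ] D} (h : PB A B C η θ)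
    (hn : ∀ g, ∀ c ∈ C, star (vv ι g) * c * vv ι g ∈ C) (g : G) {c : D} (hc : c ∈ C) :
    star (θ (vv ι g)) * c = (star (vv ι g) * c * vv ι g) * star (θ (vv ι g)) := by
  have := congrArg star (h.swap ι hn g (star_mem hc))
  simpa [mul_assoc] using this

lemma PB.swap' {η : ℝ} {θ : D →ₗ[ℂ] D} (h : PB A B C η θ)
    (hn : ∀ g, ∀ c ∈ C, star (vv ι g) * c * vv ι g ∈ C) (g : G) {c : D} (hc : c ∈ C) :
    θ (vv ι g) * c = (vv ι g * c * star (vv ι g)) * θ (vv ι g) := by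
  have h1 : vv ι g * c * star (vv ι g) ∈ C := by
    have := hn g⁻¹ c hc
    rwa [star_vv, inv_inv, ← star_vv] at this
  rw [h.swap ι hn g h1]
  have e := star_vv_mul ι g
  congr 1
  calc c = (star (vv ι g) * vv ι g) * c * (star (vv ι g) * vv ι g) := by rw [e]; simp
    _ = _ := by noncomm_ring

lemma PB.swap_star' {η : ℝ} {θ : D →ₗ[ℂ] D} (h : PB A B C η θ)
    (hn : ∀ g, ∀ c ∈ C, star (vv ι g) * c * vv ι g ∈ C) (g : G) {c : D} (hc : c ∈ C) :
    c * star (θ (vv ι g)) = star (θ (vv ι g)) * (vv ι g * c * star (vv ι g)) := by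
  have := congrArg star (h.swap' ι hn g (star_mem hc))
  simpa [mul_assoc] using this

lemma norm_mul_le_of {a b : D} {x y : ℝ} (ha : ‖a‖ ≤ x) (hb : ‖b‖ ≤ y) : ‖a * b‖ ≤ x * y :=
  (norm_mul_le _ _).trans (mul_le_mul ha hb (norm_nonneg _) ((norm_nonneg _).trans ha))

lemma stage2 (hG : FolnerAmenable G) (hB : IsClosed (B : Set D)) (hCA : C ≤ A) (hCB : C ≤ B)
    (hA : ∀ g, vv ι g ∈ A)
    (hn : ∀ g, ∀ c ∈ C, star (vv ι g) * c * vv ι g ∈ C)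
    {γ : ℝ} (hγ0 : 0 < γ) (hγ : γ < 1 / 1000) {θ₀ : D →ₗ[ℂ] D} (hθ₀ : PB A B C (2 * γ) θ₀)
    (ε : ℝ) (hε : 0 < ε) (K : Finset G) :
    ∃ θ : D →ₗ[ℂ] D, Good ι A B C (13.8 * γ) K ε θ := by
  classical
  obtain ⟨F, hF, hFK⟩ := folner_avg (D := D) hG (K.image (·⁻¹)) (ε / 10) (by positivity)
  obtain ⟨θ, hθ, hd⟩ := stage1 ι hG hB hCA hCB hA hn hγ0 hγ hθ₀ (ε / 10) (by positivity) K
  have nn := hθ.vnorm ι (by positivity) hA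
  have nr := hθ.vnear ι (by positivity) hA
  set f : G → D := fun h => star (θ (vv ι h⁻¹)) * θ (vv ι h⁻¹) with hf
  set T := avg F f with hT
  have hTB : T ∈ B := avg_mem _ _ _ fun h => mul_mem (star_mem (hθ.range _)) (hθ.range _)
  have hTs : star T = T := by rw [hT, star_avg]; exact avg_congr fun h _ => by simp [hf]
  have hTC : ∀ c ∈ C, c * T = T * c := by
    intro c hc
    rw [hT, mul_avg, avg_mul]
    refine avg_congr fun h _ => ?_
    simp only [hf]
    rw [← mul_assoc, hθ.swap_star' ι hn _ hc, mul_assoc, mul_assoc (star (θ _)), hθ.swap' ι hn _ hc]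
  have hT1 : ‖T - 1‖ ≤ 8.63 * γ := by
    refine avg_sub_const_le hF fun h _ => ?_
    set u := vv ι h⁻¹ with hu
    have e : f h - 1 = star (θ u) * (θ u - u) + star (θ u - u) * u := by
      have : star u * u = 1 := star_vv_mul ι _
      simp only [hf]
      rw [← this, star_sub, mul_sub, sub_mul]; abel
    rw [e]
    have a1 : ‖star (θ u) * (θ u - u)‖ ≤ (1 + 4.3 * γ) * (4.3 * γ) :=
      norm_mul_le_of (by rw [norm_star]; exact nn _) (nr _)
    have a2 : ‖star (θ u - u) * u‖ ≤ (4.3 * γ) * 1 :=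
      norm_mul_le_of (by rw [norm_star]; exact nr _) (vv_norm _ _)
    have := norm_add_le (star (θ u) * (θ u - u)) (star (θ u - u) * u)
    nlinarith
  obtain ⟨R, hRB, S, hSB, hRs, hSs, hRR, hRS, hSR, hRC, hSC, hR1, hS1⟩ :=
    sqrt_lemma hB hTB hTs hTC hT1 (by linarith)
  have hS2 : ‖S‖ ≤ 1.01 := hS1.trans (by rw [div_le_iff₀ (by linarith)]; linarith)
  have hR2 : ‖R‖ ≤ 1.01 := by
    have := norm_add_le (R - 1) 1
    rw [sub_add_cancel] at this
    linarith [norm_one_le (D := D)]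
  let ψ : D →ₗ[ℂ] D := (LinearMap.mulLeft ℂ R) ∘ₗ (LinearMap.mulRight ℂ S) ∘ₗ θ
  have hψ : ∀ x, ψ x = R * (θ x * S) := fun x => by simp [ψ]
  refine ⟨ψ, ⟨?_, ?_, ?_, ?_, ?_⟩, ?_, ?_⟩
  · intro x; rw [hψ]; exact mul_mem hRB (mul_mem (hθ.range _) hSB)
  · intro c hc x
    rw [hψ, hψ, hθ.left c hc, ← mul_assoc c R, hRC c hc]; simp only [mul_assoc]
  · intro c hc x
    rw [hψ, hψ, hθ.right c hc]; simp only [mul_assoc]; rw [hSC c hc]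
  · rw [hψ, hθ.one, one_mul, hRS]
  · intro x hx
    have e : ψ x - x = ((R - 1) * θ x - θ x * (R - 1)) * S + (θ x - x) := by
      rw [hψ]
      have : θ x = θ x * (R * S) := by rw [hRS, mul_one]
      have e2 : ((R - 1) * θ x - θ x * (R - 1)) * S = R * (θ x * S) - θ x * (R * S) := by
        noncomm_ring
      rw [e2, ← this]; abel
    have h1 := hθ.norm_le hx
    have a1 := norm_mul_le_of hR1 h1
    have a2 := norm_mul_le_of h1 hR1
    have a3 := norm_sub_le ((R - 1) * θ x) (θ x * (R - 1))
    have a4 := norm_mul_le_of (a3.trans (add_le_add a1 a2)) hS2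
    have a5 := hθ.near x hx
    rw [e]
    refine (norm_add_le _ _).trans ?_
    have : γ * (γ * ‖x‖) ≤ 1 / 1000 * (γ * ‖x‖) := by gcongr
    nlinarith [mul_nonneg hγ0.le (norm_nonneg x)]
  · intro x hx k hk
    have e : ψ (x * vv ι k) - ψ x * ψ (vv ι k)
        = R * ((θ (x * vv ι k) - θ x * θ (vv ι k)) * S) := by
      simp only [hψ]
      have : R * (θ x * S) * (R * (θ (vv ι k) * S)) = R * (θ x * (S * R) * θ (vv ι k) * S) := by
        noncomm_ring
      rw [this, hSR]; noncomm_ring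
    rw [e]
    have := norm_mul_le_of hR2 (norm_mul_le_of (hd x hx k hk) hS2)
    refine this.trans ?_
    nlinarith [mul_nonneg hε.le (norm_nonneg x)]
  · intro k hk
    have e : star (ψ (vv ι k)) * ψ (vv ι k) - 1
        = S * ((star (θ (vv ι k)) * T * θ (vv ι k) - T) * S) := by
      have : S * (T * S) = 1 := by
        rw [← hRR, mul_assoc R, hRS, mul_one, hSR]
      rw [hψ, sub_mul, mul_sub, this]
      simp only [star_mul, hSs, hRs, ← hRR]
      noncomm_ring
    have e2 : star (θ (vv ι k)) * T * θ (vv ι k)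
        = avg F (fun h => star (θ (vv ι h⁻¹) * θ (vv ι k)) * (θ (vv ι h⁻¹) * θ (vv ι k))) := by
      rw [hT, mul_avg, avg_mul]
      refine avg_congr fun h _ => ?_
      simp only [hf, star_mul]; noncomm_ring
    have e3 : ‖avg F (fun h => star (θ (vv ι h⁻¹) * θ (vv ι k)) * (θ (vv ι h⁻¹) * θ (vv ι k)))
        - avg F (fun h => f (k⁻¹ * h))‖ ≤ 0.3 * ε := by
      refine avg_dist_le hF fun h _ => ?_
      simp only [hf]
      have hx := hd _ (hA h⁻¹) k hk
      rw [← vv_mul] at hx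
      have hx' := hx.trans (mul_le_of_le_one_right (by positivity) (vv_norm ι _))
      have e4 : (k⁻¹ * h)⁻¹ = h⁻¹ * k := by group
      rw [e4]
      set p := θ (vv ι (h⁻¹ * k))
      set q := θ (vv ι h⁻¹) * θ (vv ι k)
      have hp : ‖star p‖ ≤ 1.01 := by rw [norm_star]; exact (nn _).trans (by linarith)
      have hq : ‖q‖ ≤ 1.01 := (norm_mul_le_of (nn _) (nn _)).trans (by nlinarith)
      have e5 : star q * q - star p * p = -(star p * (p - q)) - star (p - q) * q := by
        rw [star_sub]; noncomm_ring
      rw [e5]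
      have b1 := norm_mul_le_of hp hx'
      have b2 := norm_mul_le_of (a := star (p - q)) (x := ε / 10) (by rw [norm_star]; exact hx') hq
      have b3 := norm_sub_le (-(star p * (p - q))) (star (p - q) * q)
      rw [norm_neg] at b3
      linarith
    have e6 := hFK k⁻¹ (Finset.mem_image_of_mem _ hk) f 1.1 (fun h => by
      refine (norm_mul_le_of (x := 1 + 4.3 * γ) (by rw [norm_star]; exact nn _) (nn _)).trans
        (by nlinarith))
    have e7 : ‖star (θ (vv ι k)) * T * θ (vv ι k) - T‖ ≤ 0.5 * ε := by
      rw [e2]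
      refine (norm_sub_le_norm_sub_add_norm_sub _ (avg F (fun h => f (k⁻¹ * h))) _).trans ?_
      linarith
    rw [e]
    have := norm_mul_le_of hS2 (norm_mul_le_of e7 hS2)
    nlinarith

end Stage2


section Stage3

variable {D : Type*} [CStarAlgebra D] {G : Type*} [Group G] (ι : G →* unitary D)
  {A B C : StarSubalgebra ℂ D}

lemma st3_aux {s a b : D} {e : ℝ} (he : 0 ≤ e) (h : ‖s - a * s * star b‖ ≤ 3.2 * e)
    (hb : ‖star b * b - 1‖ ≤ e) (hs : ‖s‖ ≤ 1.03) (ha : ‖a‖ ≤ 1.014) (hbn : ‖b‖ ≤ 1.014) :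
    ‖s * b - a * s‖ ≤ 4.5 * e := by
  have e1 : s * b - a * s = (s - a * s * star b) * b + a * (s * (star b * b - 1)) := by
    noncomm_ring
  have h1 := norm_mul_le_of h hbn
  have h2 := norm_mul_le_of ha (norm_mul_le_of hs hb)
  rw [e1]
  refine (norm_add_le _ _).trans ?_
  linarith

lemma stage3 (hG : FolnerAmenable G) (hB : IsClosed (B : Set D))
    (hA : ∀ g, vv ι g ∈ A)
    (hn : ∀ g, ∀ c ∈ C, star (vv ι g) * c * vv ι g ∈ C)
    {η : ℝ} (hη0 : 0 ≤ η) (hη : η ≤ 0.0138) (ε : ℝ) (hε : 0 < ε) (K : Finset G) :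
    ∃ K' : Finset G, K ⊆ K' ∧ ∃ ε' > 0, ε' ≤ ε ∧ ∀ θ θ' : D →ₗ[ℂ] D,
      Good ι A B C η K' ε' θ → Good ι A B C η K' ε' θ' →
      ∃ u ∈ B, star u * u = 1 ∧ u * star u = 1 ∧ ‖u - 1‖ ≤ 0.1 ∧ (∀ c ∈ C, c * u = u * c) ∧
        ∀ k ∈ K, ‖u * θ' (vv ι k) * star u - θ (vv ι k)‖ ≤ ε := by
  classical
  set e := ε / 20 with he
  have hepos : 0 < e := by positivity
  obtain ⟨F, hF, hFK⟩ := folner_avg (D := D) hG K e hepos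
  refine ⟨K ∪ F, Finset.subset_union_left, e, hepos, by linarith, fun θ θ' hθ hθ' => ?_⟩
  have nn : ∀ g, ‖θ (vv ι g)‖ ≤ 1.0138 := fun g => (hθ.vnorm ι hη0 hA g).trans (by linarith)
  have nn' : ∀ g, ‖θ' (vv ι g)‖ ≤ 1.0138 := fun g => (hθ'.vnorm ι hη0 hA g).trans (by linarith)
  have nr : ∀ g, ‖θ (vv ι g) - vv ι g‖ ≤ 0.0138 := fun g => (hθ.vnear ι hη0 hA g).trans hη
  have nr' : ∀ g, ‖θ' (vv ι g) - vv ι g‖ ≤ 0.0138 := fun g => (hθ'.vnear ι hη0 hA g).trans hη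
  set f : G → D := fun h => θ (vv ι h) * star (θ' (vv ι h)) with hf
  set s := avg F f with hs
  have hsB : s ∈ B := avg_mem _ _ _ fun h => mul_mem (hθ.range _) (star_mem (hθ'.range _))
  have hsC : ∀ c ∈ C, c * s = s * c := by
    intro c hc
    rw [hs, mul_avg, avg_mul]
    refine avg_congr fun h _ => ?_
    simp only [hf]
    rw [← mul_assoc, hθ.swap ι hn _ hc, mul_assoc (θ _) (star (θ' _)), hθ'.swap_star ι hn _ hc]
    simp only [mul_assoc]
  have hsC' : ∀ c ∈ C, c * star s = star s * c := by
    intro c hc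
    have := congrArg star (hsC (star c) (star_mem hc))
    simpa using this.symm
  have hs1 : ‖s - 1‖ ≤ 0.0278 := by
    refine avg_sub_const_le hF fun h _ => ?_
    have e1 : f h - 1 = (θ (vv ι h) - vv ι h) * star (θ' (vv ι h))
        + vv ι h * star (θ' (vv ι h) - vv ι h) := by
      simp only [hf]
      rw [star_sub, mul_sub, vv_mul_star, sub_mul]; abel
    rw [e1]
    have h1 := norm_mul_le_of (b := star (θ' (vv ι h))) (y := 1.0138) (nr h)
      (by rw [norm_star]; exact nn' h)
    have h2 := norm_mul_le_of (b := star (θ' (vv ι h) - vv ι h)) (y := 0.0138) (vv_norm ι h)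
      (by rw [norm_star]; exact nr' h)
    refine (norm_add_le _ _).trans ?_
    linarith
  have hsn : ‖s‖ ≤ 1.03 := by
    have := norm_add_le (s - 1) 1
    rw [sub_add_cancel] at this
    linarith [norm_one_le (D := D)]
  have hsn' : ‖star s‖ ≤ 1.03 := by rwa [norm_star]
  have key : ∀ k ∈ K, ‖s - θ (vv ι k) * s * star (θ' (vv ι k))‖ ≤ 3.2 * e := by
    intro k hk
    have h1 := hFK k hk f 1.05 (fun h => (norm_mul_le_of (y := 1.0138) (nn h)
      (by rw [norm_star]; exact nn' h)).trans (by norm_num))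
    have h2 : ‖avg F (fun h => f (k * h)) - θ (vv ι k) * s * star (θ' (vv ι k))‖ ≤ 2.1 * e := by
      rw [hs, mul_avg, avg_mul]
      refine avg_dist_le hF fun h hh => ?_
      have a1 := (hθ.md _ (hA k) h (by simp [hh])).trans
        (mul_le_of_le_one_right hepos.le (vv_norm ι _))
      have a2 := (hθ'.md _ (hA k) h (by simp [hh])).trans
        (mul_le_of_le_one_right hepos.le (vv_norm ι _))
      rw [← vv_mul] at a1 a2
      simp only [hf]
      set p := θ (vv ι (k * h))
      set p' := θ' (vv ι (k * h))
      have e1 : p * star p' - θ (vv ι k) * (θ (vv ι h) * star (θ' (vv ι h))) * star (θ' (vv ι k))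
          = (p - θ (vv ι k) * θ (vv ι h)) * star p'
            + θ (vv ι k) * (θ (vv ι h) * star (p' - θ' (vv ι k) * θ' (vv ι h))) := by
        rw [star_sub, star_mul]; noncomm_ring
      rw [e1]
      have b1 := norm_mul_le_of (b := star p') (y := 1.0138) a1
        (by rw [norm_star]; exact nn' _)
      have b2 := norm_mul_le_of (nn k) (norm_mul_le_of
        (b := star (p' - θ' (vv ι k) * θ' (vv ι h))) (y := e) (nn h)
        (by rw [norm_star]; exact a2))
      refine (norm_add_le _ _).trans ?_
      linarith
    rw [norm_sub_rev] at h1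
    refine (norm_sub_le_norm_sub_add_norm_sub _ (avg F (fun h => f (k * h))) _).trans ?_
    linarith
  have key1 : ∀ k ∈ K, ‖s * θ' (vv ι k) - θ (vv ι k) * s‖ ≤ 4.5 * e := fun k hk =>
    st3_aux hepos.le (key k hk) (hθ'.ud k (by simp [hk])) hsn ((nn k).trans (by norm_num))
      ((nn' k).trans (by norm_num))
  have key2 : ∀ k ∈ K, ‖star s * θ (vv ι k) - θ' (vv ι k) * star s‖ ≤ 4.5 * e := fun k hk =>
    st3_aux hepos.le (by
      rw [← norm_star]
      have := key k hk
      simpa [mul_assoc] using this) (hθ.ud k (by simp [hk])) hsn' ((nn' k).trans (by norm_num))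
      ((nn k).trans (by norm_num))
  have hT1 : ‖star s * s - 1‖ ≤ 0.06 := by
    have e1 : star s * s - 1 = star s * (s - 1) + star (s - 1) := by
      rw [star_sub, star_one]; noncomm_ring
    have h1 := norm_mul_le_of hsn' hs1
    have h2 : ‖star (s - 1)‖ ≤ 0.0278 := by rwa [norm_star]
    rw [e1]
    refine (norm_add_le _ _).trans ?_
    linarith
  obtain ⟨R, hRB, S, hSB, hRs, hSs, hRR, hRS, hSR, hRC, hSC, hR1, hS1⟩ :=
    sqrt_lemma (C := C) hB (mul_mem (star_mem hsB) hsB) (by simp) (fun c hc => by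
      rw [← mul_assoc, hsC' c hc, mul_assoc, hsC c hc, mul_assoc]) hT1 (by norm_num)
  have hS2 : ‖S‖ ≤ 1.033 := hS1.trans (by rw [div_le_iff₀ (by norm_num)]; norm_num)
  have hR2 : ‖R - 1‖ ≤ 0.0312 := hR1.trans (by norm_num)
  have hS3 : ‖S - 1‖ ≤ 0.0323 := by
    have e1 : S - 1 = -(S * (R - 1)) := by rw [mul_sub, hSR]; simp
    rw [e1, norm_neg]
    exact (norm_mul_le_of hS2 hR2).trans (by norm_num)
  have hu1 : ‖s * S - 1‖ ≤ 0.1 := by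
    have e1 : s * S - 1 = (s - 1) * S + (S - 1) := by noncomm_ring
    rw [e1]
    have := norm_mul_le_of hs1 hS2
    refine (norm_add_le _ _).trans ?_
    linarith
  have huu : star (s * S) * (s * S) = 1 := by
    rw [star_mul, hSs]
    calc S * star s * (s * S) = S * (star s * s) * S := by noncomm_ring
      _ = S * R * (R * S) := by rw [← hRR]; noncomm_ring
      _ = 1 := by rw [hRS, hSR, one_mul]
  have hsSB : s * S ∈ B := mul_mem hsB hSB
  obtain ⟨w, -, hw1, hw2, -⟩ := exists_inv hB hsSB (u := 1) (by simp) (by simp)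
    (show (0.1 : ℝ) < 1 by norm_num) hu1
  have huu' : (s * S) * star (s * S) = 1 := by
    have : star (s * S) = w := by
      calc star (s * S) = star (s * S) * ((s * S) * w) := by rw [hw1, mul_one]
        _ = w := by rw [← mul_assoc, huu, one_mul]
    rw [this, hw1]
  refine ⟨s * S, hsSB, huu, huu', hu1, ?_, ?_⟩
  · intro c hc
    rw [← mul_assoc, hsC c hc, mul_assoc, hSC c hc, mul_assoc]
  · intro k hk
    set y := θ' (vv ι k) with hy
    set x := θ (vv ι k) with hx
    have k1 := key1 k hk
    have k2 := key2 k hk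
    rw [← hx, ← hy] at k1 k2
    have c1 : ‖R * R * y - y * (R * R)‖ ≤ 9.5 * e := by
      have e1 : R * R * y - y * (R * R) = star s * (s * y - x * s) + (star s * x - y * star s) * s := by
        rw [hRR]; noncomm_ring
      rw [e1]
      have h1 := norm_mul_le_of hsn' k1
      have h2 := norm_mul_le_of k2 hsn
      refine (norm_add_le _ _).trans ?_
      linarith
    have c2 : ‖R * y - y * R‖ ≤ 5 * e := by
      set Q := R * y - y * R with hQ
      have e1 : (2 : ℝ) • Q = (R * R * y - y * (R * R)) - ((R - 1) * Q + Q * (R - 1)) := by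
        rw [two_smul, hQ]; noncomm_ring
      have h1 := norm_mul_le_of hR2 (le_refl ‖Q‖)
      have h2 := norm_mul_le_of (le_refl ‖Q‖) hR2
      have h3 : 2 * ‖Q‖ = ‖(2 : ℝ) • Q‖ := by rw [norm_smul]; simp
      rw [e1] at h3
      have h4 := norm_sub_le (R * R * y - y * (R * R)) ((R - 1) * Q + Q * (R - 1))
      have h5 := norm_add_le ((R - 1) * Q) (Q * (R - 1))
      linarith
    have c3 : ‖S * y - y * S‖ ≤ 5.4 * e := by
      have e1 : S * y - y * S = -(S * ((R * y - y * R) * S)) := by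
        have : S * ((R * y - y * R) * S) = (S * R) * y * S - S * y * (R * S) := by noncomm_ring
        rw [this, hSR, hRS]; simp
      rw [e1, norm_neg]
      have := norm_mul_le_of hS2 (norm_mul_le_of c2 hS2)
      linarith
    have e2 : s * S * y * star (s * S) - x
        = (s * (S * y - y * S) + (s * y - x * s) * S) * star (s * S) := by
      have : (s * (S * y - y * S) + (s * y - x * s) * S) * star (s * S)
        = s * S * y * star (s * S) - x * ((s * S) * star (s * S)) := by noncomm_ring
      rw [this, huu', mul_one]
    rw [e2]
    have h1 := norm_mul_le_of hsn c3
    have h2 := norm_mul_le_of k1 hS2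
    have h3 := norm_add_le (s * (S * y - y * S)) ((s * y - x * s) * S)
    have h4 := norm_mul_le_of (h3.trans (add_le_add h1 h2))
      (show ‖star (s * S)‖ ≤ 1 by rw [norm_star]; exact norm_le_one_of_unitary huu)
    linarith

end Stage3


section Ctl

variable {D : Type*} [CStarAlgebra D] {G : Type*} [Group G] (ι : G →* unitary D)
  {A B C : StarSubalgebra ℂ D}

/-- The span of the elements `c * g`. -/
noncomputable def cgSpan (C : StarSubalgebra ℂ D) : Submodule ℂ D :=
  Submodule.span ℂ {x | ∃ c ∈ C, ∃ g, x = c * vv ι g}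

lemma conj_mem' (hn : ∀ g, ∀ c ∈ C, star (vv ι g) * c * vv ι g ∈ C) (g : G) {c : D} (hc : c ∈ C) :
    vv ι g * c * star (vv ι g) ∈ C := by
  have := hn g⁻¹ c hc
  rwa [star_vv, inv_inv, ← star_vv] at this

lemma cgSpan_mul (hn : ∀ g, ∀ c ∈ C, star (vv ι g) * c * vv ι g ∈ C) {x y : D}
    (hx : x ∈ cgSpan ι C) (hy : y ∈ cgSpan ι C) : x * y ∈ cgSpan ι C := by
  have h := Submodule.mul_mem_mul hx hy
  rw [cgSpan, Submodule.span_mul_span] at h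
  refine Submodule.span_mono ?_ h
  rintro _ ⟨_, ⟨c, hc, g, rfl⟩, _, ⟨c', hc', g', rfl⟩, rfl⟩
  refine ⟨c * (vv ι g * c' * star (vv ι g)), mul_mem hc (conj_mem' ι hn g hc'), g * g', ?_⟩
  rw [vv_mul]
  calc c * vv ι g * (c' * vv ι g') = c * (vv ι g * c') * 1 * vv ι g' := by noncomm_ring
    _ = c * (vv ι g * c') * (star (vv ι g) * vv ι g) * vv ι g' := by rw [star_vv_mul]
    _ = _ := by noncomm_ring

lemma cgSpan_star (hn : ∀ g, ∀ c ∈ C, star (vv ι g) * c * vv ι g ∈ C) {x : D}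
    (hx : x ∈ cgSpan ι C) : star x ∈ cgSpan ι C := by
  refine Submodule.span_induction (p := fun x _ => star x ∈ cgSpan ι C) ?_ ?_ ?_ ?_ hx
  · rintro _ ⟨c, hc, g, rfl⟩
    refine Submodule.subset_span ⟨star (vv ι g) * star c * vv ι g, hn g _ (star_mem hc), g⁻¹, ?_⟩
    rw [← star_vv, star_mul, mul_assoc _ (vv ι g), vv_mul_star, mul_one]
  · simp
  · intro x y _ _ hx hy; rw [star_add]; exact add_mem hx hy
  · intro a x _ hx; rw [star_smul]; exact Submodule.smul_mem _ _ hx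

lemma adjoin_le_cgSpan (hn : ∀ g, ∀ c ∈ C, star (vv ι g) * c * vv ι g ∈ C) {x : D}
    (hx : x ∈ StarAlgebra.adjoin ℂ ((C : Set D) ∪ Set.range (vv ι))) : x ∈ cgSpan ι C := by
  have hC : ∀ c ∈ C, c ∈ cgSpan ι C := fun c hc =>
    Submodule.subset_span ⟨c, hc, 1, by simp⟩
  induction hx using StarAlgebra.adjoin_induction with
  | mem x hx =>
    rcases hx with hx | ⟨g, rfl⟩
    · exact hC x hx
    · exact Submodule.subset_span ⟨1, one_mem _, g, by simp⟩
  | algebraMap r => exact hC _ (algebraMap_mem C r)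
  | add x y _ _ hx hy => exact add_mem hx hy
  | mul x y _ _ hx hy => exact cgSpan_mul ι hn hx hy
  | star x _ hx => exact cgSpan_star ι hn hx

/-- A property holds for all sufficiently good maps. -/
def Ev (A B C : StarSubalgebra ℂ D) (η : ℝ) (p : (D →ₗ[ℂ] D) → Prop) : Prop :=
  ∃ (K : Finset G) (ε : ℝ), 0 < ε ∧ ∀ θ, Good ι A B C η K ε θ → p θ

variable {η : ℝ}

lemma Ev.mono {p q : (D →ₗ[ℂ] D) → Prop} (h : Ev ι A B C η p)
    (hpq : ∀ θ, PB A B C η θ → p θ → q θ) : Ev ι A B C η q := by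
  obtain ⟨K, ε, hε, h⟩ := h
  exact ⟨K, ε, hε, fun θ hθ => hpq θ hθ.toPB (h θ hθ)⟩

lemma Ev.of {q : (D →ₗ[ℂ] D) → Prop}
    (hpq : ∀ θ, PB A B C η θ → q θ) : Ev ι A B C η q :=
  ⟨∅, 1, one_pos, fun θ hθ => hpq θ hθ.toPB⟩

lemma Ev.and {p q : (D →ₗ[ℂ] D) → Prop} (h : Ev ι A B C η p) (h' : Ev ι A B C η q) :
    Ev ι A B C η (fun θ => p θ ∧ q θ) := by
  classical
  obtain ⟨K, ε, hε, h⟩ := h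
  obtain ⟨K', ε', hε', h'⟩ := h'
  exact ⟨K ∪ K', min ε ε', lt_min hε hε', fun θ hθ =>
    ⟨h θ (hθ.anti ι Finset.subset_union_left (min_le_left _ _)),
     h' θ (hθ.anti ι Finset.subset_union_right (min_le_right _ _))⟩⟩

lemma Ev.all {p : D → (D →ₗ[ℂ] D) → Prop} (X : Finset D) (h : ∀ x ∈ X, Ev ι A B C η (p x)) :
    Ev ι A B C η (fun θ => ∀ x ∈ X, p x θ) := by
  classical
  induction X using Finset.induction with
  | empty => exact Ev.of ι (by simp)
  | insert a s _ ih =>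
    refine ((h a (by simp)).and ι (ih fun x hx => h x (by simp [hx]))).mono ι ?_
    rintro θ - ⟨h1, h2⟩ x hx
    rcases Finset.mem_insert.1 hx with rfl | hx
    · exact h1
    · exact h2 x hx

/-- Density of the span. -/
def Dns (A C : StarSubalgebra ℂ D) : Prop :=
  ∀ x ∈ A, ∀ δ > 0, ∃ y ∈ cgSpan ι C, ‖x - y‖ ≤ δ

lemma cgSpan_le (hCA : C ≤ A) (hA : ∀ g, vv ι g ∈ A) {x : D} (hx : x ∈ cgSpan ι C) : x ∈ A := by
  have : cgSpan ι C ≤ Subalgebra.toSubmodule A.toSubalgebra := by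
    refine Submodule.span_le.2 ?_
    rintro _ ⟨c, hc, g, rfl⟩
    exact (mul_mem (hCA hc) (hA g) : c * vv ι g ∈ A)
  exact this hx

lemma ev_mul (hCA : C ≤ A) (hA : ∀ g, vv ι g ∈ A) (hη0 : 0 ≤ η) (hη : η ≤ 1 / 10)
    (hD : Dns ι A C) {y : D} (hy : y ∈ A) (δ : ℝ) (hδ : 0 < δ) :
    Ev ι A B C η (fun θ => ∀ x ∈ A, ‖θ (x * y) - θ x * θ y‖ ≤ δ * ‖x‖) := by
  have main : ∀ y ∈ cgSpan ι C, ∀ δ > 0,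
      Ev ι A B C η (fun θ => ∀ x ∈ A, ‖θ (x * y) - θ x * θ y‖ ≤ δ * ‖x‖) := by
    intro y hy
    refine Submodule.span_induction (p := fun y _ => ∀ δ > 0,
      Ev ι A B C η (fun θ => ∀ x ∈ A, ‖θ (x * y) - θ x * θ y‖ ≤ δ * ‖x‖)) ?_ ?_ ?_ ?_ hy
    · rintro _ ⟨c, hc, g, rfl⟩ δ hδ
      refine ⟨{g}, δ / (‖c‖ + 1), by positivity, fun θ hθ x hx => ?_⟩
      rw [hθ.left c hc, ← mul_assoc, ← mul_assoc, ← hθ.right c hc]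
      refine (hθ.md _ (mul_mem hx (hCA hc)) g (by simp)).trans ?_
      have h1 := norm_mul_le x c
      rw [div_mul_eq_mul_div, div_le_iff₀ (by positivity)]
      have h2 : ‖x * c‖ ≤ ‖x‖ * (‖c‖ + 1) := h1.trans (by gcongr; linarith)
      calc δ * ‖x * c‖ ≤ δ * (‖x‖ * (‖c‖ + 1)) := by gcongr
        _ = _ := by ring
    · intro δ hδ
      refine Ev.of ι fun θ _ x _ => ?_
      simp only [mul_zero, map_zero, sub_zero, norm_zero]; positivity
    · intro y z _ _ hy hz δ hδ
      refine ((hy (δ / 2) (by positivity)).and ι (hz (δ / 2) (by positivity))).mono ι ?_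
      rintro θ - ⟨h1, h2⟩ x hx
      have e : θ (x * (y + z)) - θ x * θ (y + z)
          = (θ (x * y) - θ x * θ y) + (θ (x * z) - θ x * θ z) := by
        rw [mul_add, map_add, map_add]; noncomm_ring
      rw [e]
      refine (norm_add_le _ _).trans ?_
      linarith [h1 x hx, h2 x hx]
    · intro a y _ hy δ hδ
      refine (hy (δ / (‖a‖ + 1)) (by positivity)).mono ι ?_
      rintro θ - h1 x hx
      have e : θ (x * (a • y)) - θ x * θ (a • y) = a • (θ (x * y) - θ x * θ y) := by
        rw [mul_smul_comm, map_smul, map_smul, mul_smul_comm, smul_sub]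
      rw [e, norm_smul]
      have := h1 x hx
      rw [div_mul_eq_mul_div, le_div_iff₀ (by positivity)] at this
      nlinarith [norm_nonneg (θ (x * y) - θ x * θ y)]
  obtain ⟨z, hz, hyz⟩ := hD y hy (δ / 8) (by positivity)
  have hzA := cgSpan_le ι hCA hA hz
  refine (main z hz (δ / 2) (by positivity)).mono ι fun θ hθ h x hx => ?_
  have h0 := h x hx
  have e : θ (x * y) - θ x * θ y
      = θ (x * (y - z)) + (θ (x * z) - θ x * θ z) - θ x * θ (y - z) := by
    rw [mul_sub, map_sub, map_sub]; noncomm_ring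
  have n1 : ‖θ (y - z)‖ ≤ 1.1 * (δ / 8) := (hθ.norm_le (sub_mem hy hzA)).trans (by gcongr; linarith)
  have n2 : ‖θ x‖ ≤ 1.1 * ‖x‖ := (hθ.norm_le hx).trans (by gcongr; linarith)
  have n3 : ‖θ (x * (y - z))‖ ≤ 1.1 * (‖x‖ * (δ / 8)) :=
    (hθ.norm_le (mul_mem hx (sub_mem hy hzA))).trans
      (mul_le_mul (by linarith) (norm_mul_le_of le_rfl hyz) (norm_nonneg _) (by norm_num))
  have n4 := norm_mul_le_of n2 n1
  rw [e]
  have t1 := norm_sub_le (θ (x * (y - z)) + (θ (x * z) - θ x * θ z)) (θ x * θ (y - z))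
  have t2 := norm_add_le (θ (x * (y - z))) (θ (x * z) - θ x * θ z)
  nlinarith [mul_nonneg hδ.le (norm_nonneg x)]

lemma ev_star (hB : IsClosed (B : Set D)) (hCA : C ≤ A) (hA : ∀ g, vv ι g ∈ A)
    (hη0 : 0 ≤ η) (hη : η ≤ 1 / 10)
    (hD : Dns ι A C) {y : D} (hy : y ∈ A) (δ : ℝ) (hδ : 0 < δ) :
    Ev ι A B C η (fun θ => ‖θ (star y) - star (θ y)‖ ≤ δ) := by
  have main : ∀ y ∈ cgSpan ι C, ∀ δ > 0,
      Ev ι A B C η (fun θ => ‖θ (star y) - star (θ y)‖ ≤ δ) := by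
    intro y hy
    refine Submodule.span_induction (p := fun y _ => ∀ δ > 0,
      Ev ι A B C η (fun θ => ‖θ (star y) - star (θ y)‖ ≤ δ)) ?_ ?_ ?_ ?_ hy
    · rintro _ ⟨c, hc, g, rfl⟩ δ hδ
      refine ⟨{g}, δ / (4 * (‖c‖ + 1)), by positivity, fun θ hθ => ?_⟩
      set e := δ / (4 * (‖c‖ + 1)) with he
      have he0 : 0 < e := by positivity
      obtain ⟨w, -, hw1, hw2, hw3⟩ := exists_inv hB (hθ.range (vv ι g)) (star_vv_mul ι g)
        (vv_mul_star ι g) (show η < 1 by linarith) (hθ.vnear ι hη0 hA g)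
      have hw4 : ‖w‖ ≤ 2 := hw3.trans (by rw [div_le_iff₀ (by linarith)]; linarith)
      have h1 := (hθ.md _ (hA g⁻¹) g (by simp)).trans
        (mul_le_of_le_one_right he0.le (vv_norm ι _))
      rw [← vv_mul, inv_mul_cancel, vv_one, hθ.one] at h1
      have h2 := hθ.ud g (by simp)
      have h3 : θ (vv ι g⁻¹) - star (θ (vv ι g))
          = -((1 - θ (vv ι g⁻¹) * θ (vv ι g)) + (star (θ (vv ι g)) * θ (vv ι g) - 1)) * w := by
        have : -((1 - θ (vv ι g⁻¹) * θ (vv ι g)) + (star (θ (vv ι g)) * θ (vv ι g) - 1)) * w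
            = θ (vv ι g⁻¹) * (θ (vv ι g) * w) - star (θ (vv ι g)) * (θ (vv ι g) * w) := by
          noncomm_ring
        rw [this, hw1, mul_one, mul_one]
      have h4 : ‖θ (vv ι g⁻¹) - star (θ (vv ι g))‖ ≤ (e + e) * 2 := by
        rw [h3]
        refine norm_mul_le_of ?_ hw4
        rw [norm_neg]
        exact (norm_add_le _ _).trans (add_le_add h1 h2)
      rw [star_mul, star_vv, hθ.right _ (star_mem hc), hθ.left c hc, star_mul, ← sub_mul]
      have h5 := norm_mul_le_of h4 (show ‖star c‖ ≤ ‖c‖ + 1 by rw [norm_star]; linarith)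
      refine h5.trans (le_of_eq ?_)
      rw [he]; field_simp; norm_num
    · intro δ hδ
      refine Ev.of ι fun θ _ => ?_
      simpa using hδ.le
    · intro y z _ _ hy hz δ hδ
      refine ((hy (δ / 2) (by positivity)).and ι (hz (δ / 2) (by positivity))).mono ι ?_
      rintro θ - ⟨h1, h2⟩
      have e : θ (star (y + z)) - star (θ (y + z))
          = (θ (star y) - star (θ y)) + (θ (star z) - star (θ z)) := by
        rw [star_add, map_add, map_add, star_add]; abel
      rw [e]
      refine (norm_add_le _ _).trans ?_
      linarith
    · intro a y _ hy δ hδ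
      refine (hy (δ / (‖a‖ + 1)) (by positivity)).mono ι ?_
      rintro θ - h1
      have e : θ (star (a • y)) - star (θ (a • y)) = star a • (θ (star y) - star (θ y)) := by
        rw [star_smul, map_smul, map_smul, star_smul, smul_sub]
      rw [e, norm_smul, norm_star]
      rw [le_div_iff₀ (by positivity)] at h1
      nlinarith [norm_nonneg (θ (star y) - star (θ y))]
  obtain ⟨z, hz, hyz⟩ := hD y hy (δ / 8) (by positivity)
  have hzA := cgSpan_le ι hCA hA hz
  refine (main z hz (δ / 2) (by positivity)).mono ι fun θ hθ h => ?_
  have e : θ (star y) - star (θ y)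
      = θ (star (y - z)) + (θ (star z) - star (θ z)) - star (θ (y - z)) := by
    rw [star_sub, map_sub, map_sub, star_sub]; abel
  have n1 : ‖star (θ (y - z))‖ ≤ 1.1 * (δ / 8) := by
    rw [norm_star]; exact (hθ.norm_le (sub_mem hy hzA)).trans (by gcongr; linarith)
  have n3 : ‖θ (star (y - z))‖ ≤ 1.1 * (δ / 8) := by
    have := hθ.norm_le (star_mem (sub_mem hy hzA))
    rw [norm_star] at this
    exact this.trans (by gcongr; linarith)
  rw [e]
  have t1 := norm_sub_le (θ (star (y - z)) + (θ (star z) - star (θ z))) (star (θ (y - z)))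
  have t2 := norm_add_le (θ (star (y - z))) (θ (star z) - star (θ z))
  linarith

/-- Bounded left `C`-module maps. -/
def LB (A C : StarSubalgebra ℂ D) (φ : D →ₗ[ℂ] D) : Prop :=
  (∀ c ∈ C, ∀ x, φ (c * x) = c * φ x) ∧ ∀ x ∈ A, ‖φ x‖ ≤ 2 * ‖x‖

lemma conv_one (hCA : C ≤ A) (hA : ∀ g, vv ι g ∈ A)
    (hD : Dns ι A C) {y : D} (hy : y ∈ A) (δ : ℝ) (hδ : 0 < δ) :
    ∃ (K : Finset G) (ε : ℝ), 0 < ε ∧ ∀ φ ψ : D →ₗ[ℂ] D, LB A C φ → LB A C ψ →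
      (∀ k ∈ K, ‖φ (vv ι k) - ψ (vv ι k)‖ ≤ ε) → ‖φ y - ψ y‖ ≤ δ := by
  classical
  have main : ∀ y ∈ cgSpan ι C, ∀ δ > 0,
      ∃ (K : Finset G) (ε : ℝ), 0 < ε ∧ ∀ φ ψ : D →ₗ[ℂ] D, LB A C φ → LB A C ψ →
      (∀ k ∈ K, ‖φ (vv ι k) - ψ (vv ι k)‖ ≤ ε) → ‖φ y - ψ y‖ ≤ δ := by
    intro y hy
    refine Submodule.span_induction (p := fun y _ => ∀ δ > 0,
      ∃ (K : Finset G) (ε : ℝ), 0 < ε ∧ ∀ φ ψ : D →ₗ[ℂ] D, LB A C φ → LB A C ψ →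
      (∀ k ∈ K, ‖φ (vv ι k) - ψ (vv ι k)‖ ≤ ε) → ‖φ y - ψ y‖ ≤ δ) ?_ ?_ ?_ ?_ hy
    · rintro _ ⟨c, hc, g, rfl⟩ δ hδ
      refine ⟨{g}, δ / (‖c‖ + 1), by positivity, fun φ ψ hφ hψ h => ?_⟩
      rw [hφ.1 c hc, hψ.1 c hc, ← mul_sub]
      refine (norm_mul_le_of (show ‖c‖ ≤ ‖c‖ + 1 by linarith) (h g (by simp))).trans (le_of_eq ?_)
      field_simp
    · intro δ hδ
      exact ⟨∅, 1, one_pos, fun φ ψ _ _ _ => by simpa using hδ.le⟩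
    · intro y z _ _ hy hz δ hδ
      obtain ⟨K, ε, hε, h⟩ := hy (δ / 2) (by positivity)
      obtain ⟨K', ε', hε', h'⟩ := hz (δ / 2) (by positivity)
      refine ⟨K ∪ K', min ε ε', lt_min hε hε', fun φ ψ hφ hψ hk => ?_⟩
      have h1 := h φ ψ hφ hψ fun k hk' => (hk k (by simp [hk'])).trans (min_le_left _ _)
      have h2 := h' φ ψ hφ hψ fun k hk' => (hk k (by simp [hk'])).trans (min_le_right _ _)
      rw [map_add, map_add, add_sub_add_comm]
      refine (norm_add_le _ _).trans ?_
      linarith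
    · intro a y _ hy δ hδ
      obtain ⟨K, ε, hε, h⟩ := hy (δ / (‖a‖ + 1)) (by positivity)
      refine ⟨K, ε, hε, fun φ ψ hφ hψ hk => ?_⟩
      have h1 := h φ ψ hφ hψ hk
      rw [map_smul, map_smul, ← smul_sub, norm_smul]
      rw [le_div_iff₀ (by positivity)] at h1
      nlinarith [norm_nonneg (φ y - ψ y)]
  obtain ⟨z, hz, hyz⟩ := hD y hy (δ / 8) (by positivity)
  have hzA := cgSpan_le ι hCA hA hz
  obtain ⟨K, ε, hε, h⟩ := main z hz (δ / 2) (by positivity)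
  refine ⟨K, ε, hε, fun φ ψ hφ hψ hk => ?_⟩
  have h0 := h φ ψ hφ hψ hk
  have h1 := hφ.2 _ (sub_mem hy hzA)
  have h2 := hψ.2 _ (sub_mem hy hzA)
  have e : φ y - ψ y = φ (y - z) + (φ z - ψ z) - ψ (y - z) := by
    rw [map_sub, map_sub]; abel
  rw [e]
  have t1 := norm_sub_le (φ (y - z) + (φ z - ψ z)) (ψ (y - z))
  have t2 := norm_add_le (φ (y - z)) (φ z - ψ z)
  linarith

lemma conv_all (hCA : C ≤ A) (hA : ∀ g, vv ι g ∈ A)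
    (hD : Dns ι A C) (X : Finset D) (hX : ∀ x ∈ X, x ∈ A) (δ : ℝ) (hδ : 0 < δ) :
    ∃ (K : Finset G) (ε : ℝ), 0 < ε ∧ ∀ φ ψ : D →ₗ[ℂ] D, LB A C φ → LB A C ψ →
      (∀ k ∈ K, ‖φ (vv ι k) - ψ (vv ι k)‖ ≤ ε) → ∀ y ∈ X, ‖φ y - ψ y‖ ≤ δ := by
  classical
  induction X using Finset.induction with
  | empty => exact ⟨∅, 1, one_pos, by simp⟩
  | insert a s _ ih =>
    obtain ⟨K, ε, hε, h⟩ := ih fun x hx => hX x (by simp [hx])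
    obtain ⟨K', ε', hε', h'⟩ := conv_one ι hCA hA hD (hX a (by simp)) δ hδ
    refine ⟨K ∪ K', min ε ε', lt_min hε hε', fun φ ψ hφ hψ hk y hy => ?_⟩
    rcases Finset.mem_insert.1 hy with rfl | hy
    · exact h' φ ψ hφ hψ fun k hk' => (hk k (by simp [hk'])).trans (min_le_right _ _)
    · exact h φ ψ hφ hψ (fun k hk' => (hk k (by simp [hk'])).trans (min_le_left _ _)) y hy

/-- Unitaries of `B` commuting with `C`. -/
structure UC (B C : StarSubalgebra ℂ D) (u : D) : Prop where
  mem : u ∈ B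
  l : star u * u = 1
  r : u * star u = 1
  comm : ∀ c ∈ C, c * u = u * c

/-- Conjugation of a map by an element. -/
noncomputable def cj (u : D) (θ : D →ₗ[ℂ] D) : D →ₗ[ℂ] D :=
  (LinearMap.mulLeft ℂ u) ∘ₗ (LinearMap.mulRight ℂ (star u)) ∘ₗ θ

lemma cj_apply (u : D) (θ : D →ₗ[ℂ] D) (x : D) : cj u θ x = u * θ x * star u := by
  simp [cj, mul_assoc]

lemma UC.norm {u : D} (hu : UC B C u) : ‖u‖ ≤ 1 := norm_le_one_of_unitary hu.l
lemma UC.norm' {u : D} (hu : UC B C u) : ‖star u‖ ≤ 1 := by rw [norm_star]; exact hu.norm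
lemma UC.conj_norm {u : D} (hu : UC B C u) (x : D) : ‖u * x * star u‖ ≤ ‖x‖ := by
  have := norm_mul_le_of (norm_mul_le_of hu.norm (le_refl ‖x‖)) hu.norm'
  linarith
lemma UC.conj_norm' {u : D} (hu : UC B C u) (x : D) : ‖star u * x * u‖ ≤ ‖x‖ := by
  have := norm_mul_le_of (norm_mul_le_of hu.norm' (le_refl ‖x‖)) hu.norm
  linarith
lemma UC.one : UC B C 1 := ⟨one_mem _, by simp, by simp, by simp⟩
lemma UC.mul {u v : D} (hu : UC B C u) (hv : UC B C v) : UC B C (u * v) where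
  mem := mul_mem hu.mem hv.mem
  l := by
    rw [star_mul]
    calc star v * star u * (u * v) = star v * (star u * u) * v := by noncomm_ring
      _ = 1 := by rw [hu.l, mul_one, hv.l]
  r := by
    rw [star_mul]
    calc u * v * (star v * star u) = u * (v * star v) * star u := by noncomm_ring
      _ = 1 := by rw [hv.r, mul_one, hu.r]
  comm c hc := by rw [← mul_assoc, hu.comm c hc, mul_assoc, hv.comm c hc, mul_assoc]

lemma PB.lb {θ : D →ₗ[ℂ] D} (h : PB A B C η θ) (hη : η ≤ 1 / 10) {u : D} (hu : UC B C u) :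
    LB A C (cj u θ) := by
  refine ⟨fun c hc x => ?_, fun x hx => ?_⟩
  · rw [cj_apply, cj_apply, h.left c hc, ← mul_assoc u, ← hu.comm c hc]; simp only [mul_assoc]
  · rw [cj_apply]
    exact ((hu.conj_norm _).trans (h.norm_le hx)).trans (by gcongr; linarith)

/-- Combination of all the finite-set controls. -/
lemma control_set (hG : FolnerAmenable G) (hB : IsClosed (B : Set D)) (hCA : C ≤ A)
    (hA : ∀ g, vv ι g ∈ A)
    (hn : ∀ g, ∀ c ∈ C, star (vv ι g) * c * vv ι g ∈ C)
    (hη0 : 0 ≤ η) (hη : η ≤ 0.0138) (hD : Dns ι A C) (X : Finset D) (hX : ∀ x ∈ X, x ∈ A)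
    (δ : ℝ) (hδ : 0 < δ) :
    ∃ (K : Finset G) (ε : ℝ), 0 < ε ∧
      (∀ θ, Good ι A B C η K ε θ → ∀ y ∈ X, (∀ x ∈ A, ‖θ (x * y) - θ x * θ y‖ ≤ δ * ‖x‖) ∧
        ‖θ (star y) - star (θ y)‖ ≤ δ) ∧
      ∀ θ θ' : D →ₗ[ℂ] D, Good ι A B C η K ε θ → Good ι A B C η K ε θ' →
        ∃ u, UC B C u ∧ ‖u - 1‖ ≤ 0.1 ∧ ∀ x ∈ X, ‖u * θ' x * star u - θ x‖ ≤ δ := by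
  classical
  have hη' : η ≤ 1 / 10 := by linarith
  obtain ⟨K₁, ε₁, hε₁, h₁⟩ := Ev.all ι X (fun y hy =>
    (ev_mul (B := B) ι hCA hA hη0 hη' hD (hX y hy) δ hδ).and ι
      (ev_star ι hB hCA hA hη0 hη' hD (hX y hy) δ hδ))
  obtain ⟨K₂, ε₂, hε₂, h₂⟩ := conv_all ι hCA hA hD X hX δ hδ
  obtain ⟨K₃, -, ε₃, hε₃, -, h₃⟩ := stage3 ι hG hB hA hn hη0 hη ε₂ hε₂ K₂
  refine ⟨K₁ ∪ K₃, min ε₁ ε₃, lt_min hε₁ hε₃, fun θ hθ => h₁ θ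
    (hθ.anti ι Finset.subset_union_left (min_le_left _ _)), fun θ θ' hθ hθ' => ?_⟩
  obtain ⟨u, h1, h2, h3, h4, h5, h6⟩ := h₃ θ θ'
    (hθ.anti ι Finset.subset_union_right (min_le_right _ _))
    (hθ'.anti ι Finset.subset_union_right (min_le_right _ _))
  have hu : UC B C u := ⟨h1, h2, h3, h5⟩
  refine ⟨u, hu, h4, fun x hx => ?_⟩
  have := h₂ (cj u θ') (cj 1 θ) (hθ'.lb hη' hu) (hθ.lb hη' UC.one) (fun k hk => by
    rw [cj_apply, cj_apply]; simpa using h6 k hk) x hx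
  rw [cj_apply, cj_apply] at this
  simpa using this

end Ctl


section Limit

open Filter Topology

variable {D : Type*} [CStarAlgebra D] {A B C : StarSubalgebra ℂ D}

lemma limit_lemma (hAcl : IsClosed (A : Set D)) (hBcl : IsClosed (B : Set D)) (hCA : C ≤ A)
    (φ : ℕ → D →ₗ[ℂ] D) (X : ℕ → Finset D) {δ : ℝ} (hδ : 0 < δ)
    (hXA : ∀ n, ∀ x ∈ X n, x ∈ A) (hXm : ∀ n, X n ⊆ X (n + 1))
    (hdense : ∀ x ∈ A, ∀ e > 0, ∃ n, ∃ y ∈ X n, ‖x - y‖ ≤ e)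
    (hφB : ∀ n x, φ n x ∈ B) (hφC : ∀ n, ∀ c ∈ C, φ n c = c)
    (hup : ∀ n, ∀ x ∈ A, ‖φ n x‖ ≤ 2 * ‖x‖) (hlo : ∀ n, ∀ x ∈ A, 0.5 * ‖x‖ ≤ ‖φ n x‖)
    (hstep : ∀ n, ∀ x ∈ X n, ‖φ (n + 1) x - φ n x‖ ≤ δ / 2 ^ n)
    (hmul : ∀ n, ∀ y ∈ X n, ∀ x ∈ A, ‖φ n (x * y) - φ n x * φ n y‖ ≤ δ / 2 ^ n * ‖x‖)
    (hstar : ∀ n, ∀ y ∈ X n, ‖φ n (star y) - star (φ n y)‖ ≤ δ / 2 ^ n)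
    (hsurj : ∀ b ∈ B, ∀ e > 0, ∀ N, ∃ n ≥ N, ∃ x ∈ X n, ‖φ n x - b‖ ≤ 0.4 * ‖b‖ + e) :
    ∃ α : A ≃⋆ₐ[ℂ] B,
      (∀ c : D, ∀ hc : c ∈ C, ((α ⟨c, hCA hc⟩ : B) : D) = c) ∧
      (∀ x ∈ X 0, ∀ hx : x ∈ A, ‖((α ⟨x, hx⟩ : B) : D) - φ 0 x‖ ≤ 2 * δ) := by
  have hmono : ∀ m n, m ≤ n → X m ⊆ X n := fun m n h => monotone_nat_of_le_succ hXm h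
  have htail' : ∀ m, ∀ x ∈ X m, ∀ j, ‖φ (m + j) x - φ m x‖ ≤ 2 * δ / 2 ^ m - 2 * δ / 2 ^ (m + j) := by
    intro m x hx j
    induction j with
    | zero => simp
    | succ j ih =>
      have h1 := hstep (m + j) x (hmono _ _ (Nat.le_add_right m j) hx)
      have h2 := norm_sub_le_norm_sub_add_norm_sub (φ (m + j + 1) x) (φ (m + j) x) (φ m x)
      have h3 : 2 * δ / 2 ^ (m + (j + 1)) = δ / 2 ^ (m + j) := by
        rw [← add_assoc, pow_succ]; field_simp
      have h4 : 2 * δ / 2 ^ (m + j) = 2 * (δ / 2 ^ (m + j)) := by ring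
      rw [h3]; rw [h4] at ih
      rw [← add_assoc]
      linarith
  have htail : ∀ m n, m ≤ n → ∀ x ∈ X m, ‖φ n x - φ m x‖ ≤ 2 * δ / 2 ^ m := by
    intro m n hmn x hx
    obtain ⟨j, rfl⟩ := Nat.exists_eq_add_of_le hmn
    have : 0 < 2 * δ / 2 ^ (m + j) := by positivity
    linarith [htail' m x hx j]
  have hpow : Tendsto (fun n : ℕ => δ / 2 ^ n) atTop (𝓝 0) := by
    exact (tendsto_const_nhds (x := δ)).div_atTop (tendsto_pow_atTop_atTop_of_one_lt one_lt_two)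
  have hpow2 : Tendsto (fun n : ℕ => 2 * δ / 2 ^ n) atTop (𝓝 0) :=
    (tendsto_const_nhds (x := 2 * δ)).div_atTop (tendsto_pow_atTop_atTop_of_one_lt one_lt_two)
  have hcau : ∀ x ∈ A, CauchySeq (fun n => φ n x) := by
    intro x hx
    refine Metric.cauchySeq_iff'.2 fun e he => ?_
    obtain ⟨m, y, hy, hxy⟩ := hdense x hx (e / 8) (by positivity)
    obtain ⟨N, hN, hmN⟩ := ((hpow2.eventually_lt_const (show 0 < e / 4 by positivity)).and
      (eventually_ge_atTop m)).exists
    refine ⟨N, fun n hn => ?_⟩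
    have hyA := hXA m y hy
    have h1 := htail N n hn y (hmono m N hmN hy)
    have h2 := hup n _ (sub_mem hx hyA)
    have h3 := hup N _ (sub_mem hx hyA)
    rw [dist_eq_norm]
    have e1 : φ n x - φ N x = φ n (x - y) + (φ n y - φ N y) - φ N (x - y) := by
      rw [map_sub, map_sub]; abel
    rw [e1]
    have t1 := norm_sub_le (φ n (x - y) + (φ n y - φ N y)) (φ N (x - y))
    have t2 := norm_add_le (φ n (x - y)) (φ n y - φ N y)
    linarith
  have hlim : ∀ x, ∃ y, x ∈ A → Tendsto (fun n => φ n x) atTop (𝓝 y) := by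
    intro x
    by_cases hx : x ∈ A
    · obtain ⟨y, hy⟩ := cauchySeq_tendsto_of_complete (hcau x hx)
      exact ⟨y, fun _ => hy⟩
    · exact ⟨0, fun h => absurd h hx⟩
  choose L hL using hlim
  have LB' : ∀ x ∈ A, L x ∈ B := fun x hx =>
    hBcl.mem_of_tendsto (hL x hx) (Eventually.of_forall fun n => hφB n x)
  have Lup : ∀ x ∈ A, ‖L x‖ ≤ 2 * ‖x‖ := fun x hx =>
    le_of_tendsto' (hL x hx).norm fun n => hup n x hx
  have Llo : ∀ x ∈ A, 0.5 * ‖x‖ ≤ ‖L x‖ := fun x hx =>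
    ge_of_tendsto' (hL x hx).norm fun n => hlo n x hx
  have LC : ∀ c ∈ C, L c = c := fun c hc =>
    tendsto_nhds_unique (hL c (hCA hc)) (by simp [hφC _ c hc])
  have Ladd : ∀ x ∈ A, ∀ y ∈ A, L (x + y) = L x + L y := fun x hx y hy =>
    tendsto_nhds_unique (hL _ (add_mem hx hy)) (by
      simpa only [map_add] using (hL x hx).add (hL y hy))
  have Lsub : ∀ x ∈ A, ∀ y ∈ A, L (x - y) = L x - L y := fun x hx y hy =>
    tendsto_nhds_unique (hL _ (sub_mem hx hy)) (by
      simpa only [map_sub] using (hL x hx).sub (hL y hy))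
  have Lmul0 : ∀ m, ∀ y ∈ X m, ∀ x ∈ A, L (x * y) = L x * L y := by
    intro m y hy x hx
    have hyA := hXA m y hy
    have h1 := (hL _ (mul_mem hx hyA)).sub ((hL x hx).mul (hL y hyA))
    have h2 : Tendsto (fun n => φ n (x * y) - φ n x * φ n y) atTop (𝓝 0) := by
      refine squeeze_zero_norm' (a := fun n => δ / 2 ^ n * ‖x‖) ?_ (by
        simpa using hpow.mul_const ‖x‖)
      filter_upwards [eventually_ge_atTop m] with n hn
      exact hmul n y (hmono m n hn hy) x hx
    exact sub_eq_zero.1 (tendsto_nhds_unique h1 h2)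
  have Lstar0 : ∀ m, ∀ y ∈ X m, L (star y) = star (L y) := by
    intro m y hy
    have hyA := hXA m y hy
    have h1 := (hL _ (star_mem hyA)).sub (hL y hyA).star
    have h2 : Tendsto (fun n => φ n (star y) - star (φ n y)) atTop (𝓝 0) := by
      refine squeeze_zero_norm' (a := fun n => δ / 2 ^ n) ?_ hpow
      filter_upwards [eventually_ge_atTop m] with n hn
      exact hstar n y (hmono m n hn hy)
    exact sub_eq_zero.1 (tendsto_nhds_unique h1 h2)
  have small : ∀ (v : D) (M : ℝ), 0 ≤ M → (∀ e > 0, ‖v‖ ≤ M * e) → v = 0 := by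
    intro v M hM h
    rw [← norm_le_zero_iff]
    refine le_of_forall_pos_le_add fun e he => ?_
    have := h (e / (M + 1)) (by positivity)
    refine this.trans ?_
    rw [zero_add, mul_div_assoc', div_le_iff₀ (by positivity)]
    nlinarith
  have Lmul : ∀ x ∈ A, ∀ y ∈ A, L (x * y) = L x * L y := by
    intro x hx y hy
    refine sub_eq_zero.1 (small _ (6 * ‖x‖) (by positivity) fun e he => ?_)
    obtain ⟨m, z, hz, hyz⟩ := hdense y hy e he
    have hzA := hXA m z hz
    have h0 := Lmul0 m z hz x hx
    have e1 : L (x * y) - L x * L y = L (x * (y - z)) - L x * L (y - z) := by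
      rw [mul_sub, Lsub _ (mul_mem hx hy) _ (mul_mem hx hzA), Lsub _ hy _ hzA, h0]; noncomm_ring
    have n1 := (Lup _ (mul_mem hx (sub_mem hy hzA))).trans
      (mul_le_mul_of_nonneg_left (norm_mul_le_of (le_refl ‖x‖) hyz) (by norm_num))
    have n2 := (Lup _ (sub_mem hy hzA)).trans (mul_le_mul_of_nonneg_left hyz (by norm_num))
    have n3 := norm_mul_le_of (Lup x hx) n2
    rw [e1]
    refine (norm_sub_le _ _).trans ?_
    nlinarith
  have Lstar : ∀ y ∈ A, L (star y) = star (L y) := by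
    intro y hy
    refine sub_eq_zero.1 (small _ 4 (by positivity) fun e he => ?_)
    obtain ⟨m, z, hz, hyz⟩ := hdense y hy e he
    have hzA := hXA m z hz
    have h0 := Lstar0 m z hz
    have e1 : L (star y) - star (L y) = L (star (y - z)) - star (L (y - z)) := by
      rw [star_sub, Lsub _ (star_mem hy) _ (star_mem hzA), Lsub _ hy _ hzA, h0, star_sub]; abel
    have n1 := Lup _ (star_mem (sub_mem hy hzA))
    have n2 := Lup _ (sub_mem hy hzA)
    rw [norm_star] at n1
    rw [e1]
    refine (norm_sub_le _ _).trans ?_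
    rw [norm_star]
    linarith
  let α₀ : A →⋆ₐ[ℂ] B :=
    { toFun := fun x => ⟨L x, LB' x x.2⟩
      map_one' := Subtype.ext (LC 1 (one_mem _))
      map_mul' := fun x y => Subtype.ext (Lmul x x.2 y y.2)
      map_zero' := Subtype.ext (LC 0 (zero_mem _))
      map_add' := fun x y => Subtype.ext (Ladd x x.2 y y.2)
      commutes' := fun r => Subtype.ext (LC _ (algebraMap_mem C r))
      map_star' := fun x => Subtype.ext (Lstar x x.2) }
  have hα₀ : ∀ x : A, ((α₀ x : B) : D) = L x := fun _ => rfl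
  have hinj : Function.Injective α₀ := by
    refine (injective_iff_map_eq_zero α₀).2 fun x hx => ?_
    have h1 := Llo x x.2
    have h2 : L x = 0 := by rw [← hα₀, hx]; rfl
    rw [h2, norm_zero] at h1
    have : ‖(x : D)‖ ≤ 0 := by linarith
    exact Subtype.ext (norm_le_zero_iff.1 this)
  -- the range is closed
  set M : Set D := L '' (A : Set D) with hM
  have hMcl : IsClosed M := by
    refine IsSeqClosed.isClosed fun f b hf hfb => ?_
    choose x hxA hxf using hf
    have hc : CauchySeq x := by
      refine Metric.cauchySeq_iff'.2 fun e he => ?_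
      obtain ⟨N, hN⟩ := Metric.cauchySeq_iff'.1 hfb.cauchySeq (e / 4) (by positivity)
      refine ⟨N, fun n hn => ?_⟩
      have h1 := hN n hn
      rw [dist_eq_norm, ← hxf, ← hxf, ← Lsub _ (hxA n) _ (hxA N)] at h1
      have h2 := Llo _ (sub_mem (hxA n) (hxA N))
      rw [dist_eq_norm]
      linarith
    obtain ⟨y, hy⟩ := cauchySeq_tendsto_of_complete hc
    have hyA : y ∈ A := hAcl.mem_of_tendsto hy (Eventually.of_forall hxA)
    refine ⟨y, hyA, tendsto_nhds_unique (f := f) (l := atTop) ?_ hfb⟩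
    rw [tendsto_iff_norm_sub_tendsto_zero]
    refine squeeze_zero (fun _ => norm_nonneg _) (g := fun n => 2 * ‖x n - y‖) (fun n => ?_) ?_
    · rw [← hxf, ← Lsub _ (hxA n) _ hyA]
      exact Lup _ (sub_mem (hxA n) hyA)
    · have := (tendsto_iff_norm_sub_tendsto_zero.1 hy).const_mul 2
      simpa using this
  have happ : ∀ b ∈ B, ∀ e > 0, ∃ m ∈ M, ‖m - b‖ ≤ 0.4 * ‖b‖ + e := by
    intro b hb e he
    obtain ⟨N, hN⟩ := (hpow2.eventually_lt_const (show 0 < e / 2 by positivity)).exists_forall_of_atTop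
    obtain ⟨n, hn, x, hx, hxb⟩ := hsurj b hb (e / 2) (by positivity) N
    have hxA := hXA n x hx
    refine ⟨L x, ⟨x, hxA, rfl⟩, ?_⟩
    have h1 : ‖L x - φ n x‖ ≤ 2 * δ / 2 ^ n :=
      le_of_tendsto ((hL x hxA).sub_const _).norm (by
        filter_upwards [eventually_ge_atTop n] with k hk
        exact htail n k hk x hx)
    have h2 := hN n hn
    have h3 := norm_sub_le_norm_sub_add_norm_sub (L x) (φ n x) b
    linarith
  have hMne : M.Nonempty := ⟨L 0, 0, zero_mem _, rfl⟩
  have hMB : ∀ b ∈ B, b ∈ M := by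
    intro b hb
    rw [hMcl.mem_iff_infDist_zero hMne]
    by_contra hne
    have hpos : 0 < Metric.infDist b M := lt_of_le_of_ne Metric.infDist_nonneg (Ne.symm hne)
    set d := Metric.infDist b M with hd
    obtain ⟨m, ⟨x, hx, rfl⟩, hm⟩ := (Metric.infDist_lt_iff hMne).1 (show d < 1.5 * d by linarith)
    rw [dist_eq_norm] at hm
    obtain ⟨m', ⟨x', hx', rfl⟩, hm'⟩ := happ (b - L x) (sub_mem hb (LB' x hx)) (d / 10)
      (by positivity)
    have h1 : d ≤ dist b (L (x + x')) :=
      Metric.infDist_le_dist_of_mem ⟨x + x', add_mem hx hx', rfl⟩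
    rw [dist_eq_norm, Ladd x hx x' hx', norm_sub_rev] at h1
    have e1 : L x + L x' - b = L x' - (b - L x) := by abel
    rw [e1] at h1
    linarith
  have hsur : Function.Surjective α₀ := by
    rintro ⟨b, hb⟩
    obtain ⟨x, hx, hxb⟩ := hMB b hb
    exact ⟨⟨x, hx⟩, Subtype.ext hxb⟩
  refine ⟨StarAlgEquiv.ofBijective α₀ ⟨hinj, hsur⟩, fun c hc => LC c hc, fun x hx hxA => ?_⟩
  change ‖L x - φ 0 x‖ ≤ 2 * δ
  refine le_of_tendsto' ((hL x hxA).sub_const _).norm fun k => ?_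
  simpa using htail 0 k (Nat.zero_le k) x hx

lemma exists_dep_seq {S : Type*} (Inv : ℕ → S → Prop) (Rel : ℕ → S → S → Prop) (s0 : S)
    (h0 : Inv 0 s0) (step : ∀ n s, Inv n s → ∃ s', Inv (n + 1) s' ∧ Rel n s s') :
    ∃ f : ℕ → S, f 0 = s0 ∧ (∀ n, Inv n (f n)) ∧ ∀ n, Rel n (f n) (f (n + 1)) := by
  have : ∀ n s, ∃ s', Inv n s → Inv (n + 1) s' ∧ Rel n s s' := by
    intro n s
    by_cases h : Inv n s
    · obtain ⟨s', hs'⟩ := step n s h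
      exact ⟨s', fun _ => hs'⟩
    · exact ⟨s, fun h' => absurd h' h⟩
  choose g hg using this
  let f : ℕ → S := fun n => Nat.rec s0 (fun n s => g n s) n
  have hf : ∀ n, Inv n (f n) := by
    intro n
    induction n with
    | zero => exact h0
    | succ n ih => exact (hg n _ ih).1
  exact ⟨f, rfl, hf, fun n => (hg n _ (hf n)).2⟩

end Limit


section Intertwine

open Filter Topology

variable {D : Type*} [CStarAlgebra D] {G : Type*} [Group G] (ι : G →* unitary D)
  {A B C : StarSubalgebra ℂ D}

/-- The state of the intertwining recursion. -/
structure IState (D : Type*) [CStarAlgebra D] (G : Type*) where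
  X : Finset D
  V : D
  θ : D →ₗ[ℂ] D
  K : Finset G
  ε : ℝ

/-- The invariant of the intertwining recursion. -/
structure IInv (A B C : StarSubalgebra ℂ D) (η δ : ℝ) (s : IState D G) : Prop where
  sub : ∀ x ∈ s.X, x ∈ A
  uc : UC B C s.V
  pos : 0 < s.ε
  good : Good ι A B C η s.K s.ε s.θ
  ctl1 : ∀ θ, Good ι A B C η s.K s.ε θ → ∀ y ∈ s.X,
    (∀ x ∈ A, ‖θ (x * y) - θ x * θ y‖ ≤ δ * ‖x‖) ∧ ‖θ (star y) - star (θ y)‖ ≤ δ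
  ctl2 : ∀ θ θ' : D →ₗ[ℂ] D, Good ι A B C η s.K s.ε θ → Good ι A B C η s.K s.ε θ' →
        ∃ u, UC B C u ∧ ‖u - 1‖ ≤ 0.1 ∧ ∀ x ∈ s.X, ‖u * θ' x * star u - θ x‖ ≤ δ

lemma intertwine (hG : FolnerAmenable G) (hAcl : IsClosed (A : Set D)) (hB : IsClosed (B : Set D))
    (hCA : C ≤ A) (hCB : C ≤ B)
    (hA : ∀ g, vv ι g ∈ A)
    (hn : ∀ g, ∀ c ∈ C, star (vv ι g) * c * vv ι g ∈ C)
    {γ : ℝ} (hγ0 : 0 < γ) (hγ : γ < 1 / 1000) {θ₀ : D →ₗ[ℂ] D} (hθ₀ : PB A B C (2 * γ) θ₀)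
    (hD : Dns ι A C) (a : ℕ → D) (haA : ∀ i, a i ∈ A)
    (ha : ∀ x ∈ A, ∀ e > 0, ∃ i, ‖x - a i‖ ≤ e)
    (b : ℕ → D) (hbB : ∀ i, b i ∈ B) (hb : ∀ x ∈ B, ∀ e > 0, ∃ i, ‖x - b i‖ ≤ e)
    (happ : ∀ y ∈ B, ∃ x ∈ A, ‖x - y‖ ≤ 0.01 * ‖y‖)
    (X : Finset D) (hX : ∀ x ∈ X, x ∈ A ∧ ‖x‖ ≤ 1) :
    ∃ α : A ≃⋆ₐ[ℂ] B,
      (∀ c : D, ∀ hc : c ∈ C, ((α ⟨c, hCA hc⟩ : B) : D) = c) ∧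
      (∀ x ∈ X, ∀ hx : x ∈ A, ‖((α ⟨x, hx⟩ : B) : D) - x‖ ≤ 15 * γ) := by
  classical
  set η := 13.8 * γ with hη
  have hη0 : 0 ≤ η := by positivity
  have hη1 : η ≤ 0.0138 := by rw [hη]; linarith
  set δ := γ / 2 with hδ
  have hδ0 : 0 < δ := by positivity
  have st2 := fun ε hε K => stage2 ι hG hB hCA hCB hA hn hγ0 hγ hθ₀ ε hε K
  have ctl := fun X hX δ hδ => control_set (B := B) ι hG hB hCA hA hn hη0 hη1 hD X hX δ hδ
  have happ' : ∀ y, ∃ x, y ∈ B → x ∈ A ∧ ‖x - y‖ ≤ 0.01 * ‖y‖ := by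
    intro y
    by_cases hy : y ∈ B
    · obtain ⟨x, hx⟩ := happ y hy; exact ⟨x, fun _ => hx⟩
    · exact ⟨0, fun h => absurd h hy⟩
  choose ap hap using happ'
  obtain ⟨K₀, ε₀, hε₀, c₁, c₂⟩ := ctl X (fun x hx => (hX x hx).1) (δ / 2 ^ 0) (by positivity)
  obtain ⟨ψ₀, hψ₀⟩ := st2 ε₀ hε₀ K₀
  have step : ∀ (n : ℕ) (s : IState D G), IInv ι A B C η (δ / 2 ^ n) s →
      ∃ s' : IState D G, IInv ι A B C η (δ / 2 ^ (n + 1)) s' ∧ (s.X ⊆ s'.X ∧ a n ∈ s'.X ∧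
      (∀ x ∈ s.X, ‖cj s'.V s'.θ x - cj s.V s.θ x‖ ≤ δ / 2 ^ n) ∧
      ∀ i ≤ n, ∃ x ∈ s'.X, ‖cj s'.V s'.θ x - b i‖ ≤ 0.3 * ‖b i‖) := by
    intro n s hs
    set V := s.V with hV
    have hVB : ∀ i, star V * b i * V ∈ B := fun i =>
      mul_mem (mul_mem (star_mem hs.uc.mem) (hbB i)) hs.uc.mem
    set X' := s.X ∪ {a n} ∪ (Finset.range (n + 1)).image (fun i => ap (star V * b i * V)) with hX'
    have hX'A : ∀ x ∈ X', x ∈ A := by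
      intro x hx
      rw [hX', Finset.mem_union, Finset.mem_union, Finset.mem_singleton, Finset.mem_image] at hx
      rcases hx with (hx | rfl) | ⟨i, -, rfl⟩
      · exact hs.sub x hx
      · exact haA n
      · exact (hap _ (hVB i)).1
    obtain ⟨K₁, ε₁, hε₁, d₁, d₂⟩ := ctl X' hX'A (δ / 2 ^ (n + 1)) (by positivity)
    obtain ⟨θ', hθ'⟩ := st2 (min s.ε ε₁) (lt_min hs.pos hε₁) (s.K ∪ K₁)
    have g1 := hθ'.anti ι (Finset.subset_union_left) (min_le_left s.ε ε₁)
    have g2 := hθ'.anti ι (Finset.subset_union_right) (min_le_right s.ε ε₁)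
    obtain ⟨u, hu, hu1, hux⟩ := hs.ctl2 s.θ θ' hs.good g1
    have hcj : ∀ x, cj (V * u) θ' x = V * (u * θ' x * star u) * star V := by
      intro x; rw [cj_apply, star_mul]; noncomm_ring
    refine ⟨⟨X', V * u, θ', K₁, ε₁⟩, ⟨hX'A, hs.uc.mul hu, hε₁, g2, d₁, d₂⟩, ?_, ?_, ?_, ?_⟩
    · intro x hx; simp [hX', hx]
    · simp [hX']
    · intro x hx
      have e : cj (V * u) θ' x - cj V s.θ x = V * (u * θ' x * star u - s.θ x) * star V := by
        rw [hcj, cj_apply]; noncomm_ring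
      change ‖cj (V * u) θ' x - cj V s.θ x‖ ≤ _
      rw [e]
      exact (hs.uc.conj_norm _).trans (hux x hx)
    · intro i hi
      set y := star V * b i * V with hy
      have hyn : ‖y‖ ≤ ‖b i‖ := hs.uc.conj_norm' _
      obtain ⟨hxA, hxy⟩ := hap y (hVB i)
      set x := ap y with hx
      refine ⟨x, ?_, ?_⟩
      · change x ∈ X'
        rw [hX']
        refine Finset.mem_union_right _ (Finset.mem_image.2 ⟨i, ?_, rfl⟩)
        simp; omega
      · change ‖cj (V * u) θ' x - b i‖ ≤ _
        have e1 : cj (V * u) θ' x - b i = V * (u * θ' x * star u - y) * star V := by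
          have : V * (u * θ' x * star u - y) * star V
              = V * (u * θ' x * star u) * star V - (V * star V) * b i * (V * star V) := by
            rw [hy]; noncomm_ring
          rw [this, hcj, hs.uc.r]; simp
        rw [e1]
        refine (hs.uc.conj_norm _).trans ?_
        have e2 : u * θ' x * star u - y = (u - 1) * (θ' x * star u) + θ' x * star (u - 1)
            + (θ' x - x) + (x - y) := by
          rw [star_sub, star_one]; noncomm_ring
        have hxn : ‖x‖ ≤ 1.01 * ‖b i‖ := by
          have := norm_add_le (x - y) y
          rw [sub_add_cancel] at this
          linarith
        have n1 : ‖θ' x‖ ≤ 1.0138 * (1.01 * ‖b i‖) := (hθ'.norm_le hxA).trans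
          (mul_le_mul (by linarith) hxn (norm_nonneg _) (by norm_num))
        have n2 : ‖θ' x - x‖ ≤ 0.0138 * (1.01 * ‖b i‖) := (hθ'.near x hxA).trans
          (mul_le_mul hη1 hxn (norm_nonneg _) (by norm_num))
        have n3 := norm_mul_le_of hu1 (norm_mul_le_of n1 hu.norm')
        have n4 := norm_mul_le_of n1 (show ‖star (u - 1)‖ ≤ 0.1 by rw [norm_star]; exact hu1)
        rw [e2]
        have t1 := norm_add_le ((u - 1) * (θ' x * star u) + θ' x * star (u - 1)
            + (θ' x - x)) (x - y)
        have t2 := norm_add_le ((u - 1) * (θ' x * star u) + θ' x * star (u - 1)) (θ' x - x)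
        have t3 := norm_add_le ((u - 1) * (θ' x * star u)) (θ' x * star (u - 1))
        linarith [norm_nonneg (b i)]
  obtain ⟨f, hf0, hfI, hfR⟩ := exists_dep_seq
    (fun n (s : IState D G) => IInv ι A B C η (δ / 2 ^ n) s) _
    (⟨X, 1, ψ₀, K₀, ε₀⟩ : IState D G)
    ⟨fun x hx => (hX x hx).1, UC.one, hε₀, hψ₀, c₁, c₂⟩ step
  have cjm : ∀ n x y, cj (f n).V (f n).θ x * cj (f n).V (f n).θ y
      = (f n).V * ((f n).θ x * (f n).θ y) * star (f n).V := by
    intro n x y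
    rw [cj_apply, cj_apply]
    calc _ = (f n).V * (f n).θ x * (star (f n).V * (f n).V) * (f n).θ y * star (f n).V := by
          noncomm_ring
      _ = _ := by rw [(hfI n).uc.l]; noncomm_ring
  have hback : ∀ n (x : D), ‖x‖ ≤ ‖(f n).V * x * star (f n).V‖ := by
    intro n x
    have h1 := (hfI n).uc.conj_norm' ((f n).V * x * star (f n).V)
    have e : star (f n).V * ((f n).V * x * star (f n).V) * (f n).V = x := by
      calc _ = (star (f n).V * (f n).V) * x * (star (f n).V * (f n).V) := by noncomm_ring
        _ = x := by rw [(hfI n).uc.l]; simp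
    rwa [e] at h1
  obtain ⟨α, h1, h2⟩ := limit_lemma (C := C) hAcl hB hCA (fun n => cj (f n).V (f n).θ)
    (fun n => (f n).X) hδ0 (fun n => (hfI n).sub) (fun n => (hfR n).1)
    (by
      intro x hx e he
      obtain ⟨i, hi⟩ := ha x hx e he
      exact ⟨i + 1, a i, (hfR i).2.1, hi⟩)
    (by
      intro n x
      simp only [cj_apply]
      exact mul_mem (mul_mem (hfI n).uc.mem ((hfI n).good.range x)) (star_mem (hfI n).uc.mem))
    (by
      intro n c hc
      simp only [cj_apply]
      rw [(hfI n).good.fix hc, ← (hfI n).uc.comm c hc, mul_assoc, (hfI n).uc.r, mul_one])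
    (by
      intro n x hx
      exact ((hfI n).good.toPB.lb (by linarith) (hfI n).uc).2 x hx)
    (by
      intro n x hx
      simp only [cj_apply]
      refine le_trans ?_ (hback n _)
      have h1 := (hfI n).good.near x hx
      have h2 := norm_sub_norm_le x ((f n).θ x)
      rw [norm_sub_rev] at h2
      have h3 : η * ‖x‖ ≤ 0.0138 * ‖x‖ := by gcongr
      linarith [norm_nonneg x])
    (fun n => (hfR n).2.2.1)
    (by
      intro n y hy x hx
      simp only [cjm]
      have e : cj (f n).V (f n).θ (x * y) - (f n).V * ((f n).θ x * (f n).θ y) * star (f n).V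
          = (f n).V * ((f n).θ (x * y) - (f n).θ x * (f n).θ y) * star (f n).V := by
        rw [cj_apply]; noncomm_ring
      rw [e]
      exact ((hfI n).uc.conj_norm _).trans (((hfI n).ctl1 _ (hfI n).good y hy).1 x hx))
    (by
      intro n y hy
      have e : cj (f n).V (f n).θ (star y) - star (cj (f n).V (f n).θ y)
          = (f n).V * ((f n).θ (star y) - star ((f n).θ y)) * star (f n).V := by
        rw [cj_apply, cj_apply, star_mul, star_mul, star_star]; noncomm_ring
      simp only [e]
      exact ((hfI n).uc.conj_norm _).trans (((hfI n).ctl1 _ (hfI n).good y hy).2))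
    (by
      intro y hy e he N
      obtain ⟨i, hi⟩ := hb y hy (e / 4) (by positivity)
      obtain ⟨x, hx, hxb⟩ := (hfR (max i N)).2.2.2 i (le_max_left _ _)
      refine ⟨max i N + 1, (le_max_right i N).trans (Nat.le_succ _), x, hx, ?_⟩
      have t1 := norm_sub_le_norm_sub_add_norm_sub
        (cj (f (max i N + 1)).V (f (max i N + 1)).θ x) (b i) y
      rw [norm_sub_rev (b i) y] at t1
      have t2 := norm_sub_norm_le (b i) y
      rw [norm_sub_rev (b i) y] at t2
      linarith [norm_nonneg y])
  refine ⟨α, h1, fun x hx hxA => ?_⟩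
  have h3 := h2 x (by simpa only [hf0] using hx) hxA
  simp only [hf0, cj_apply] at h3
  have h4 : ‖ψ₀ x - x‖ ≤ η * ‖x‖ := hψ₀.near x hxA
  have h5 := (hX x hx).2
  rw [one_mul, star_one, mul_one] at h3
  have t := norm_sub_le_norm_sub_add_norm_sub ((α ⟨x, hxA⟩ : B) : D) (ψ₀ x) x
  have h6 : η * ‖x‖ ≤ η := mul_le_of_le_one_right hη0 h5
  linarith

end Intertwine


lemma kk_approx {D : Type*} [CStarAlgebra D] {S T : StarSubalgebra ℂ D} {γ : ℝ}
    (h : kkDist (S : Set D) (T : Set D) < γ) {x : D} (hx : x ∈ S) :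
    ∃ y ∈ T, ‖x - y‖ ≤ γ * ‖x‖ := by
  have hfin : Metric.hausdorffEDist {x ∈ (S : Set D) | ‖x‖ ≤ 1} {x ∈ (T : Set D) | ‖x‖ ≤ 1} ≠ ⊤ := by
    refine Metric.hausdorffEDist_ne_top_of_nonempty_of_bounded ⟨0, zero_mem S, by simp⟩
      ⟨0, zero_mem T, by simp⟩ ?_ ?_ <;>
    · refine (Metric.isBounded_closedBall (x := (0 : D)) (r := 1)).subset ?_
      rintro y ⟨-, hy⟩
      simpa using hy
  by_cases hx0 : x = 0
  · exact ⟨0, zero_mem T, by simp [hx0]⟩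
  have hxn : 0 < ‖x‖ := norm_pos_iff.2 hx0
  set r : ℂ := ((‖x‖ : ℝ) : ℂ) with hr
  have hrn : ‖r‖ = ‖x‖ := by rw [hr]; simp
  have hr0 : r ≠ 0 := by rw [hr]; exact_mod_cast hxn.ne'
  obtain ⟨y, ⟨hyT, -⟩, hy⟩ := Metric.exists_dist_lt_of_hausdorffDist_lt (x := r⁻¹ • x)
    (show r⁻¹ • x ∈ {x ∈ (S : Set D) | ‖x‖ ≤ 1} from ⟨S.smul_mem hx _, by
      rw [norm_smul, norm_inv, hrn, inv_mul_cancel₀ hxn.ne']⟩) h hfin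
  refine ⟨r • y, T.smul_mem hyT _, ?_⟩
  have e : x - r • y = r • (r⁻¹ • x - y) := by
    rw [smul_sub, smul_smul, mul_inv_cancel₀ hr0, one_smul]
  rw [e, norm_smul, hrn, mul_comm]
  rw [dist_eq_norm] at hy
  gcongr

lemma sep_seq {D : Type*} [CStarAlgebra D] (S : StarSubalgebra ℂ D)
    (h : TopologicalSpace.IsSeparable (S : Set D)) :
    ∃ a : ℕ → D, (∀ i, a i ∈ S) ∧ ∀ x ∈ S, ∀ e > 0, ∃ i, ‖x - a i‖ ≤ e := by
  have : TopologicalSpace.SeparableSpace S := h.separableSpace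
  refine ⟨fun i => (TopologicalSpace.denseSeq S i : D), fun i => (TopologicalSpace.denseSeq S i).2,
    fun x hx e he => ?_⟩
  obtain ⟨i, hi⟩ := (TopologicalSpace.denseRange_denseSeq S).exists_dist_lt ⟨x, hx⟩ he
  refine ⟨i, ?_⟩
  rw [Subtype.dist_eq, dist_eq_norm] at hi
  exact hi.le

theorem stmt18 {D : Type*} [CStarAlgebra D]
    (C A B : StarSubalgebra ℂ D)
    (hC_closed : IsClosed (C : Set D)) (hA_closed : IsClosed (A : Set D))
    (hB_closed : IsClosed (B : Set D))
    (hCA : C ≤ A) (hCB : C ≤ B)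
    (hA_sep : TopologicalSpace.IsSeparable (A : Set D))
    (hB_sep : TopologicalSpace.IsSeparable (B : Set D))
    -- `E` is a conditional expectation of `D` onto `B`:
    (E : D →ₗ[ℂ] D)
    (hE_range : ∀ x, E x ∈ B) (hE_fix : ∀ b ∈ B, E b = b) (hE_contr : ∀ x, ‖E x‖ ≤ ‖x‖)
    -- `C ⊆ A` is crossed product-like by a discrete amenable group `U`:
    (U : Subgroup (unitary D))
    (hUA : ∀ u ∈ U, ((u : unitary D) : D) ∈ A)
    (hUnorm : ∀ u ∈ U,
      (fun x => ((u : unitary D) : D) * x * star ((u : unitary D) : D)) '' (C : Set D) =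
        (C : Set D))
    (hgen : (StarAlgebra.adjoin ℂ ((C : Set D) ∪
        ((fun u : unitary D => (u : D)) '' (U : Set (unitary D))))).topologicalClosure = A)
    (hU_amen : FolnerAmenable U)
    (γ : ℝ) (hd : kkDist (A : Set D) (B : Set D) < γ) (hγ : γ < 1 / 1000)
    (X : Finset D) (hX : ∀ x ∈ X, x ∈ A ∧ ‖x‖ ≤ 1) :
    ∃ α : A ≃⋆ₐ[ℂ] B,
      (∀ c : D, ∀ hc : c ∈ C, ((α ⟨c, hCA hc⟩ : B) : D) = c) ∧
      (∀ x ∈ X, ∀ hx : x ∈ A, ‖((α ⟨x, hx⟩ : B) : D) - x‖ ≤ 15 * γ) := by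
  have hγ0 : 0 < γ := lt_of_le_of_lt Metric.hausdorffDist_nonneg hd
  have hd' : kkDist (B : Set D) (A : Set D) < γ := by
    rw [kkDist, Metric.hausdorffDist_comm]; exact hd
  have hA : ∀ g : U, vv U.subtype g ∈ A := fun g => hUA _ g.2
  have hn : ∀ g : U, ∀ c ∈ C, star (vv U.subtype g) * c * vv U.subtype g ∈ C := by
    intro g c hc
    have h1 : c ∈ (fun x => ((g : unitary D) : D) * x * star ((g : unitary D) : D)) '' (C : Set D) := by
      rw [hUnorm _ g.2]; exact hc
    obtain ⟨c', hc', rfl⟩ := h1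
    have h2 : star (vv U.subtype g) * vv U.subtype g = 1 := star_vv_mul _ g
    have e : star (vv U.subtype g) * (vv U.subtype g * c' * star (vv U.subtype g))
        * vv U.subtype g = c' := by
      calc _ = (star (vv U.subtype g) * vv U.subtype g) * c' * (star (vv U.subtype g)
            * vv U.subtype g) := by noncomm_ring
        _ = c' := by rw [h2]; simp
    exact (congrArg (· ∈ C) e).mpr hc'
  have hθ₀ : PB A B C (2 * γ) E := by
    refine ⟨hE_range, fun c hc x => tom_left B hB_closed E hE_range hE_fix hE_contr c (hCB hc) x,
      fun c hc x => tom_right B hB_closed E hE_range hE_fix hE_contr c (hCB hc) x,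
      hE_fix 1 (one_mem _), fun x hx => ?_⟩
    obtain ⟨y, hy, hxy⟩ := kk_approx hd hx
    have e : E x - x = E (x - y) - (x - y) := by rw [map_sub, hE_fix y hy]; abel
    rw [e]
    have := norm_sub_le (E (x - y)) (x - y)
    linarith [hE_contr (x - y)]
  have hD : Dns U.subtype A C := by
    intro x hx δ hδ
    rw [← hgen] at hx
    have hx' : x ∈ closure ((StarAlgebra.adjoin ℂ ((C : Set D) ∪
        ((fun u : unitary D => (u : D)) '' (U : Set (unitary D)))) : StarSubalgebra ℂ D) : Set D) := by
      rwa [← StarSubalgebra.topologicalClosure_coe]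
    obtain ⟨y, hy, hxy⟩ := Metric.mem_closure_iff.1 hx' δ hδ
    refine ⟨y, adjoin_le_cgSpan U.subtype hn ?_, by rw [← dist_eq_norm]; exact hxy.le⟩
    have e : Set.range (vv U.subtype) = (fun u : unitary D => (u : D)) '' (U : Set (unitary D)) := by
      ext z; constructor
      · rintro ⟨g, rfl⟩; exact ⟨g, g.2, rfl⟩
      · rintro ⟨g, hg, rfl⟩; exact ⟨⟨g, hg⟩, rfl⟩
    rw [e]; exact hy
  obtain ⟨a, haA, ha⟩ := sep_seq A hA_sep
  obtain ⟨b, hbB, hb⟩ := sep_seq B hB_sep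
  refine intertwine U.subtype hU_amen hA_closed hB_closed hCA hCB hA hn hγ0 hγ hθ₀ hD a haA ha
    b hbB hb (fun y hy => ?_) X hX
  obtain ⟨x, hx, hxy⟩ := kk_approx hd' hy
  refine ⟨x, hx, ?_⟩
  rw [norm_sub_rev]
  refine hxy.trans ?_
  gcongr
  linarith
end
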